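/- Let d ≥ 3, Lu = −u_t + a^{jk}(t, x′)D_{jk}u with coefficients depending only on (t, x′) and tr a = a^{11} + a^{22} depending only on t. Let κ ≥ 2 and r > 0, and assume u ∈ C₀^∞(ℝ^{d+1}) satisfies Lu = 0 in Q_{κr}. Then there exist constants N = N(d, δ) and α = α(d, δ) ∈ (0, 1] such that for any multi-index γ″ involving only the x″ variables, the average over Q_r of |D^{γ″}u − (D^{γ″}u)_{Q_r}|² is at most Nκ^{−2α} times the average over Q_{κr} of |D^{γ″}u|². -/

import Mathlib

open MeasureTheory Real Set Filter
open scoped ENNReal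

noncomputable section

/-- First-order partial derivative of `u : ℝ × ℝ^d → ℝ` in the `j`-th space coordinate. -/
def pd {d : ℕ} (j : Fin d) (u : ℝ × (Fin d → ℝ) → ℝ) : ℝ × (Fin d → ℝ) → ℝ :=
  fun p => deriv (fun s => u (p.1, Function.update p.2 j s)) (p.2 j)

/-- Second-order partial derivative `D_{jk} u` in the space coordinates. -/
def pd2 {d : ℕ} (j k : Fin d) (u : ℝ × (Fin d → ℝ) → ℝ) : ℝ × (Fin d → ℝ) → ℝ :=
  pd j (pd k u)

/-- Time derivative `u_t`. -/
def pt {d : ℕ} (u : ℝ × (Fin d → ℝ) → ℝ) : ℝ × (Fin d → ℝ) → ℝ :=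
  fun p => deriv (fun s => u (s, p.2)) p.1

/-- Spatial gradient `Du`, as a Euclidean-space valued function. -/
def sgrad {d : ℕ} (u : ℝ × (Fin d → ℝ) → ℝ) (p : ℝ × (Fin d → ℝ)) :
    EuclideanSpace ℝ (Fin d) :=
  (WithLp.equiv 2 (Fin d → ℝ)).symm fun j => pd j u p

/-- Spatial Hessian `D²u`, as a Euclidean-space valued function (Frobenius norm). -/
def shess {d : ℕ} (u : ℝ × (Fin d → ℝ) → ℝ) (p : ℝ × (Fin d → ℝ)) :
    EuclideanSpace ℝ (Fin d × Fin d) :=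
  (WithLp.equiv 2 (Fin d × Fin d → ℝ)).symm fun jk => pd2 jk.1 jk.2 u p

/-- The half space `ℝ^{d+1}_T = (-∞, T) × ℝ^d`, with `T ∈ (-∞, +∞]` an extended real. -/
def halfSpace (d : ℕ) (T : EReal) : Set (ℝ × (Fin d → ℝ)) := {p | (p.1 : EReal) < T}

/-- `u ∈ W^{1,2}_p(μ)` : `u`, `u_t`, `Du`, `D²u` all belong to `L_p(μ)`. -/
def MemW12 {d : ℕ} (p : ℝ≥0∞) (μ : Measure (ℝ × (Fin d → ℝ)))
    (u : ℝ × (Fin d → ℝ) → ℝ) : Prop :=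
  MemLp u p μ ∧ MemLp (pt u) p μ ∧ MemLp (sgrad u) p μ ∧ MemLp (shess u) p μ

/-- The parabolic operator `Lu = -u_t + a^{jk} D_{jk} u + b^j D_j u + c u`. -/
def parOp {d : ℕ} (a : ℝ × (Fin d → ℝ) → Fin d → Fin d → ℝ)
    (b : ℝ × (Fin d → ℝ) → Fin d → ℝ) (c : ℝ × (Fin d → ℝ) → ℝ)
    (u : ℝ × (Fin d → ℝ) → ℝ) : ℝ × (Fin d → ℝ) → ℝ :=
  fun p => -(pt u p) + (∑ j, ∑ k, a p j k * pd2 j k u p)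
    + (∑ j, b p j * pd j u p) + c p * u p

/-- Symmetry and uniform ellipticity with constant `δ`:
`a^{jk} = a^{kj}` and `δ|ξ|² ≤ a^{jk} ξ^j ξ^k ≤ δ⁻¹ |ξ|²`. -/
def Elliptic {d : ℕ} (δ : ℝ) (a : ℝ × (Fin d → ℝ) → Fin d → Fin d → ℝ) : Prop :=
  ∀ p, (∀ j k, a p j k = a p k j) ∧
    ∀ ξ : Fin d → ℝ,
      δ * (∑ j, ξ j ^ 2) ≤ ∑ j, ∑ k, a p j k * ξ j * ξ k ∧
      ∑ j, ∑ k, a p j k * ξ j * ξ k ≤ δ⁻¹ * (∑ j, ξ j ^ 2)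

/-- `tr a = a^{11} + a^{22}`. -/
def trA {d : ℕ} (hd : 2 ≤ d) (a : ℝ × (Fin d → ℝ) → Fin d → Fin d → ℝ)
    (p : ℝ × (Fin d → ℝ)) : ℝ :=
  a p ⟨0, by omega⟩ ⟨0, by omega⟩ + a p ⟨1, by omega⟩ ⟨1, by omega⟩

/-- The parabolic cylinder `Q_ρ(t₀, x₀) = (t₀ - ρ², t₀) × B'_ρ(x₀') × B''_ρ(x₀'')`. -/
def cylQ (d : ℕ) (t₀ : ℝ) (x₀ : Fin d → ℝ) (ρ : ℝ) : Set (ℝ × (Fin d → ℝ)) :=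
  {p | p.1 ∈ Set.Ioo (t₀ - ρ ^ 2) t₀ ∧
    (∑ j : Fin d, if (j : ℕ) < 2 then (p.2 j - x₀ j) ^ 2 else 0) < ρ ^ 2 ∧
    (∑ j : Fin d, if (j : ℕ) < 2 then 0 else (p.2 j - x₀ j) ^ 2) < ρ ^ 2}

/-- `patch x z` keeps the first two coordinates of `x` and takes the remaining coordinates
from `z`; with it one expresses the averaging of a coefficient in the `x''` variables. -/
def patch {d : ℕ} (x z : Fin d → ℝ) : Fin d → ℝ :=
  fun j => if (j : ℕ) < 2 then x j else z j

/-- **Assumption 2.7 (γ)**: (a) `tr a` oscillates by at most `γ` in `x'` over distances `≤ R₀`;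
(b) if `d ≥ 3`, on every parabolic cylinder of radius `ρ ≤ R₀` the mean oscillation over the
cylinder of `a^{jk}` from its average `ā^{jk}(r, x')` in the `x''` variables is at most `γ`.
(Averaging `a (p.1, patch p.2 q.2)` in `q` over the cylinder is exactly the average of
`a^{jk}(p.1, p.2', ·)` over the ball `B''`, since the integrand only depends on `q.2''`.) -/
def AssumptionGamma {d : ℕ} (hd : 2 ≤ d) (γ R₀ : ℝ)
    (a : ℝ × (Fin d → ℝ) → Fin d → Fin d → ℝ) : Prop :=
  (∀ (t : ℝ) (x y : Fin d → ℝ),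
    (∀ i : Fin d, 2 ≤ (i : ℕ) → x i = y i) →
    (∑ j : Fin d, if (j : ℕ) < 2 then (x j - y j) ^ 2 else 0) ≤ R₀ ^ 2 →
    |trA hd a (t, x) - trA hd a (t, y)| ≤ γ) ∧
  (3 ≤ d → ∀ (t₀ : ℝ) (x₀ : Fin d → ℝ) (ρ : ℝ), 0 < ρ → ρ ≤ R₀ → ∀ j k : Fin d,
    (⨍ p in cylQ d t₀ x₀ ρ,
      |a p j k - ⨍ q in cylQ d t₀ x₀ ρ, a (p.1, patch p.2 q.2) j k ∂volume| ∂volume) ≤ γ)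

/-- Iterated partial derivative `D^{γ} u` corresponding to a list of coordinate directions. -/
def pdList {d : ℕ} (ms : List (Fin d)) (u : ℝ × (Fin d → ℝ) → ℝ) :
    ℝ × (Fin d → ℝ) → ℝ :=
  ms.foldr (fun j w => pd j w) u

/-! ### Calculus infrastructure -/

abbrev Sm {d : ℕ} (v : ℝ × (Fin d → ℝ) → ℝ) : Prop := ContDiff ℝ (⊤ : ℕ∞) v

lemma update_eq_add {d : ℕ} (x : Fin d → ℝ) (j : Fin d) (s : ℝ) :
    Function.update x j s = x + (s - x j) • (Pi.single j 1 : Fin d → ℝ) := by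
  ext i
  by_cases h : i = j
  · subst h; simp
  · simp [h]

lemma line_hasDerivAt {d : ℕ} {v : ℝ × (Fin d → ℝ) → ℝ} (hv : Sm v) (p w : ℝ × (Fin d → ℝ)) (s : ℝ) :
    HasDerivAt (fun s : ℝ => v (p + s • w)) (fderiv ℝ v (p + s • w) w) s := by
  have h1 : HasFDerivAt v (fderiv ℝ v (p + s • w)) (p + s • w) :=
    (hv.differentiable (by simp)).differentiableAt.hasFDerivAt
  have h2 : HasDerivAt (fun s : ℝ => p + s • w) w s := by
    simpa using ((hasDerivAt_id s).smul_const w).const_add p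
  exact h1.comp_hasDerivAt s h2

lemma pd_eq {d : ℕ} {v : ℝ × (Fin d → ℝ) → ℝ} (hv : Sm v) (j : Fin d) (p : ℝ × (Fin d → ℝ)) :
    pd j v p = fderiv ℝ v p (0, Pi.single j 1) := by
  have h := line_hasDerivAt hv p ((0 : ℝ), (Pi.single j 1 : Fin d → ℝ)) (p.2 j - p.2 j)
  have h3 : HasDerivAt (fun s : ℝ => v (p.1, Function.update p.2 j s))
      (fderiv ℝ v (p + (p.2 j - p.2 j) • ((0 : ℝ), (Pi.single j 1 : Fin d → ℝ))) (0, Pi.single j 1)) (p.2 j) := by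
    have := h.comp_sub_const (p.2 j) (p.2 j)
    have he : (fun s : ℝ => v (p.1, Function.update p.2 j s)) =
        fun s => v (p + (s - p.2 j) • ((0 : ℝ), (Pi.single j 1 : Fin d → ℝ))) := by
      funext s
      congr 1
      refine Prod.ext ?_ ?_
      · simp
      · simp [update_eq_add]
    rw [he]; exact this
  simpa [pd] using h3.deriv

lemma pt_eq {d : ℕ} {v : ℝ × (Fin d → ℝ) → ℝ} (hv : Sm v) (p : ℝ × (Fin d → ℝ)) :
    pt v p = fderiv ℝ v p (1, 0) := by
  have h := line_hasDerivAt hv p ((1 : ℝ), (0 : Fin d → ℝ)) (p.1 - p.1)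
  have h3 : HasDerivAt (fun s : ℝ => v (s, p.2))
      (fderiv ℝ v (p + (p.1 - p.1) • ((1 : ℝ), (0 : Fin d → ℝ))) (1, 0)) (p.1) := by
    have := h.comp_sub_const (p.1) (p.1)
    have he : (fun s : ℝ => v (s, p.2)) =
        fun s => v (p + (s - p.1) • ((1 : ℝ), (0 : Fin d → ℝ))) := by
      funext s
      congr 1
      refine Prod.ext ?_ ?_ <;> simp
    rw [he]; exact this
  simpa [pt] using h3.deriv

lemma Sm.dir {d : ℕ} {v : ℝ × (Fin d → ℝ) → ℝ} (hv : Sm v) (w : ℝ × (Fin d → ℝ)) :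
    Sm (fun p => fderiv ℝ v p w) :=
  (hv.fderiv_right (m := ((⊤ : ℕ∞) : WithTop ℕ∞)) (by simp)).clm_apply contDiff_const

lemma Sm.pd {d : ℕ} {v : ℝ × (Fin d → ℝ) → ℝ} (hv : Sm v) (j : Fin d) : Sm (pd j v) := by
  have : _root_.pd j v = fun p => fderiv ℝ v p (0, Pi.single j 1) := funext (pd_eq hv j)
  rw [this]; exact hv.dir _

lemma Sm.pt {d : ℕ} {v : ℝ × (Fin d → ℝ) → ℝ} (hv : Sm v) : Sm (pt v) := by
  have : _root_.pt v = fun p => fderiv ℝ v p (1, 0) := funext (pt_eq hv)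
  rw [this]; exact hv.dir _

lemma dir_comm {d : ℕ} {v : ℝ × (Fin d → ℝ) → ℝ} (hv : Sm v) (w z p : ℝ × (Fin d → ℝ)) :
    fderiv ℝ (fun p => fderiv ℝ v p w) p z = fderiv ℝ (fun p => fderiv ℝ v p z) p w := by
  have hd : DifferentiableAt ℝ (fderiv ℝ v) p :=
    ((hv.fderiv_right (m := 1) (by norm_cast)).differentiable (by simp)).differentiableAt
  have hs : IsSymmSndFDerivAt ℝ v p :=
    hv.contDiffAt.isSymmSndFDerivAt (by simp only [minSmoothness_of_isRCLikeNormedField]; exact WithTop.coe_le_coe.2 le_top)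
  rw [fderiv_clm_apply hd (differentiableAt_const _), fderiv_clm_apply hd (differentiableAt_const _)]
  simpa using hs.eq z w

lemma pd_comm {d : ℕ} {v : ℝ × (Fin d → ℝ) → ℝ} (hv : Sm v) (j k : Fin d) :
    pd j (pd k v) = pd k (pd j v) := by
  ext p
  rw [pd_eq (hv.pd k), pd_eq (hv.pd j), funext (pd_eq hv k), funext (pd_eq hv j)]
  exact dir_comm hv _ _ _

lemma pd_pt_comm {d : ℕ} {v : ℝ × (Fin d → ℝ) → ℝ} (hv : Sm v) (k : Fin d) :
    pd k (pt v) = pt (pd k v) := by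
  ext p
  rw [pd_eq hv.pt, pt_eq (hv.pd k), funext (pd_eq hv k), funext (pt_eq hv)]
  exact dir_comm hv _ _ _

lemma pd2_symm {d : ℕ} {v : ℝ × (Fin d → ℝ) → ℝ} (hv : Sm v) (j k : Fin d) :
    pd2 j k v = pd2 k j v := pd_comm hv j k

lemma fderiv_sdir {d : ℕ} {v : ℝ × (Fin d → ℝ) → ℝ} (hv : Sm v) (p : ℝ × (Fin d → ℝ)) (ξ : Fin d → ℝ) :
    fderiv ℝ v p (0, ξ) = ∑ j, ξ j * pd j v p := by
  have : ((0 : ℝ), ξ) = ∑ j, ξ j • ((0 : ℝ), (Pi.single j 1 : Fin d → ℝ)) := by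
    ext i
    · simp [Prod.fst_sum]
    · simp [Finset.sum_apply, Pi.single_apply, Prod.snd_sum]
  rw [this, map_sum]
  simp_rw [map_smul, pd_eq hv, smul_eq_mul]

/-- derivative along a spatial line -/
lemma sline {d : ℕ} {v : ℝ × (Fin d → ℝ) → ℝ} (hv : Sm v) (t : ℝ) (x ξ : Fin d → ℝ) (s : ℝ) :
    HasDerivAt (fun s : ℝ => v (t, x + s • ξ)) (∑ j, ξ j * pd j v (t, x + s • ξ)) s := by
  have h := line_hasDerivAt hv (t, x) (0, ξ) s
  simp only [Prod.smul_mk, Prod.mk_add_mk, smul_zero, add_zero] at h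
  rwa [fderiv_sdir hv] at h

lemma sline2 {d : ℕ} {v : ℝ × (Fin d → ℝ) → ℝ} (hv : Sm v) (t : ℝ) (x ξ : Fin d → ℝ) (s : ℝ) :
    HasDerivAt (fun s : ℝ => ∑ j, ξ j * pd j v (t, x + s • ξ))
      (∑ j, ∑ k, ξ j * ξ k * pd2 j k v (t, x + s • ξ)) s := by
  have : HasDerivAt (fun s : ℝ => ∑ j, ξ j * pd j v (t, x + s • ξ))
      (∑ j, ξ j * ∑ k, ξ k * pd k (pd j v) (t, x + s • ξ)) s := by
    apply HasDerivAt.fun_sum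
    intro j _
    exact (sline (hv.pd j) t x ξ s).const_mul _
  convert this using 1
  refine Finset.sum_congr rfl fun j _ => ?_
  rw [Finset.mul_sum]
  refine Finset.sum_congr rfl fun k _ => ?_
  rw [pd2, pd_comm hv]; ring

lemma tline {d : ℕ} {v : ℝ × (Fin d → ℝ) → ℝ} (hv : Sm v) (t : ℝ) (x : Fin d → ℝ) :
    HasDerivAt (fun s : ℝ => v (s, x)) (pt v (t, x)) t := by
  have h := line_hasDerivAt hv (0, x) (1, 0) t
  rw [pt_eq hv]
  simpa using h

lemma second_test {g g' : ℝ → ℝ} {g2 : ℝ} (h1 : ∀ s, HasDerivAt g (g' s) s)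
    (h2 : HasDerivAt g' g2 0) (hmax : IsLocalMax g 0) : g2 ≤ 0 := by
  by_contra hc
  push Not at hc
  have hd : deriv g = g' := funext fun s => (h1 s).deriv
  have h0 : deriv g 0 = 0 := hmax.deriv_eq_zero
  set f : ℝ → ℝ := fun s => g s - (g2 / 4) * s ^ 2 with hf
  have hf1 : ∀ s, HasDerivAt f (g' s - (g2 / 2) * s) s := by
    intro s
    have := (h1 s).fun_sub ((hasDerivAt_pow 2 s).const_mul (g2 / 4))
    refine this.congr_deriv ?_
    push_cast; ring
  have hf2 : HasDerivAt (fun s => g' s - (g2 / 2) * s) (g2 - g2 / 2) 0 := by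
    have := h2.fun_sub ((hasDerivAt_id' (0:ℝ)).const_mul (g2 / 2))
    refine this.congr_deriv ?_
    ring
  have hdf : deriv f = fun s => g' s - (g2 / 2) * s := funext fun s => (hf1 s).deriv
  have hmin : IsLocalMin f 0 := by
    apply isLocalMin_of_deriv_deriv_pos
    · rw [hdf, hf2.deriv]; linarith
    · rw [hdf]; simp [← hd, h0]
    · exact (hf1 0).continuousAt
  have hb : ∀ᶠ s in nhds (0:ℝ), s = 0 := by
    filter_upwards [hmin, hmax] with s hs1 hs2
    simp only [hf] at hs1
    by_contra hne
    have : 0 < s ^ 2 := by positivity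
    nlinarith
  have hb' : ∀ᶠ s in nhdsWithin (0:ℝ) {0}ᶜ, s = 0 := hb.filter_mono nhdsWithin_le_nhds
  have hb2 : ∀ᶠ s in nhdsWithin (0:ℝ) {0}ᶜ, s ≠ 0 := eventually_mem_nhdsWithin
  have := (hb'.and hb2).exists
  obtain ⟨s, h, h'⟩ := this
  exact h' h

/-- first derivative test from the left -/
lemma first_test {g : ℝ → ℝ} {g1 t : ℝ} (h1 : HasDerivAt g g1 t)
    (hmax : ∀ᶠ s in nhdsWithin t (Iio t), g s ≤ g t) : 0 ≤ g1 := by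
  have h2 := h1.hasDerivWithinAt (s := Iio t)
  have h3 := hasDerivWithinAt_iff_tendsto_slope.1 h2
  have : Iio t \ {t} = Iio t := by ext; simp
  rw [this] at h3
  refine ge_of_tendsto h3 ?_
  filter_upwards [hmax, self_mem_nhdsWithin] with s hs hst
  rw [slope_def_field]
  have : s < t := hst
  exact div_nonneg_of_nonpos (by linarith) (by linarith)

/-! ### The operator, product rules, the maximum principle -/

def Lop {d : ℕ} (a : ℝ × (Fin d → ℝ) → Fin d → Fin d → ℝ) (u : ℝ × (Fin d → ℝ) → ℝ)
    (p : ℝ × (Fin d → ℝ)) : ℝ := -(pt u p) + ∑ j, ∑ k, a p j k * pd2 j k u p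

/-- the bilinear form `a^{jk} ξ_j η_k` -/
def bil {d : ℕ} (A : Fin d → Fin d → ℝ) (ξ η : Fin d → ℝ) : ℝ := ∑ j, ∑ k, A j k * ξ j * η k

lemma bil_add_left {d : ℕ} (A : Fin d → Fin d → ℝ) (ξ η ζ : Fin d → ℝ) :
    bil A (fun j => ξ j + η j) ζ = bil A ξ ζ + bil A η ζ := by
  simp only [bil, ← Finset.sum_add_distrib]
  refine Finset.sum_congr rfl fun j _ => Finset.sum_congr rfl fun k _ => by ring

lemma bil_smul_left {d : ℕ} (A : Fin d → Fin d → ℝ) (c : ℝ) (ξ ζ : Fin d → ℝ) :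
    bil A (fun j => c * ξ j) ζ = c * bil A ξ ζ := by
  simp only [bil, Finset.mul_sum]
  refine Finset.sum_congr rfl fun j _ => Finset.sum_congr rfl fun k _ => by ring

lemma bil_symm {d : ℕ} (A : Fin d → Fin d → ℝ) (hA : ∀ j k, A j k = A k j) (ξ ζ : Fin d → ℝ) :
    bil A ξ ζ = bil A ζ ξ := by
  simp only [bil]
  rw [Finset.sum_comm]
  refine Finset.sum_congr rfl fun j _ => Finset.sum_congr rfl fun k _ => by rw [hA k j]; ring

lemma parOp_eq {d : ℕ} (a : ℝ × (Fin d → ℝ) → Fin d → Fin d → ℝ) (u : ℝ × (Fin d → ℝ) → ℝ)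
    (p : ℝ × (Fin d → ℝ)) : parOp a (fun _ _ => 0) (fun _ => 0) u p = Lop a u p := by
  simp [parOp, Lop]

lemma pd_mul {d : ℕ} {f g : ℝ × (Fin d → ℝ) → ℝ} (hf : Sm f) (hg : Sm g) (j : Fin d) :
    pd j (fun p => f p * g p) = fun p => f p * pd j g p + pd j f p * g p := by
  ext p
  rw [pd_eq (hf.mul hg), pd_eq hf, pd_eq hg,
    fderiv_fun_mul (hf.differentiable (by simp)).differentiableAt
      (hg.differentiable (by simp)).differentiableAt]
  simp; ring

lemma pt_mul {d : ℕ} {f g : ℝ × (Fin d → ℝ) → ℝ} (hf : Sm f) (hg : Sm g) :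
    pt (fun p => f p * g p) = fun p => f p * pt g p + pt f p * g p := by
  ext p
  rw [pt_eq (hf.mul hg), pt_eq hf, pt_eq hg,
    fderiv_fun_mul (hf.differentiable (by simp)).differentiableAt
      (hg.differentiable (by simp)).differentiableAt]
  simp; ring

lemma pd_add {d : ℕ} {f g : ℝ × (Fin d → ℝ) → ℝ} (hf : Sm f) (hg : Sm g) (j : Fin d) :
    pd j (fun p => f p + g p) = fun p => pd j f p + pd j g p := by
  ext p
  rw [pd_eq (hf.add hg), pd_eq hf, pd_eq hg,
    fderiv_fun_add (hf.differentiable (by simp)).differentiableAt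
      (hg.differentiable (by simp)).differentiableAt]
  simp

lemma pt_add {d : ℕ} {f g : ℝ × (Fin d → ℝ) → ℝ} (hf : Sm f) (hg : Sm g) :
    pt (fun p => f p + g p) = fun p => pt f p + pt g p := by
  ext p
  rw [pt_eq (hf.add hg), pt_eq hf, pt_eq hg,
    fderiv_fun_add (hf.differentiable (by simp)).differentiableAt
      (hg.differentiable (by simp)).differentiableAt]
  simp

lemma pd_const {d : ℕ} (c : ℝ) (j : Fin d) :
    pd j (fun _ : ℝ × (Fin d → ℝ) => c) = fun _ => 0 := by
  ext p; simp [pd]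

lemma pt_const {d : ℕ} (c : ℝ) :
    pt (fun _ : ℝ × (Fin d → ℝ) => c) = fun _ => 0 := by
  ext p; simp [pt]

lemma Lop_add {d : ℕ} (a : ℝ × (Fin d → ℝ) → Fin d → Fin d → ℝ) {f g : ℝ × (Fin d → ℝ) → ℝ}
    (hf : Sm f) (hg : Sm g) (p : ℝ × (Fin d → ℝ)) :
    Lop a (fun p => f p + g p) p = Lop a f p + Lop a g p := by
  have h2 : ∀ j k, pd2 j k (fun p => f p + g p) p = pd2 j k f p + pd2 j k g p := by
    intro j k
    simp only [pd2]
    rw [pd_add hf hg, pd_add (hf.pd k) (hg.pd k)]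
  simp only [Lop, h2, pt_add hf hg, mul_add, Finset.sum_add_distrib]
  ring

lemma Lop_mul {d : ℕ} (a : ℝ × (Fin d → ℝ) → Fin d → Fin d → ℝ) {f g : ℝ × (Fin d → ℝ) → ℝ}
    (hf : Sm f) (hg : Sm g) (p : ℝ × (Fin d → ℝ)) (hs : ∀ j k, a p j k = a p k j) :
    Lop a (fun p => f p * g p) p = f p * Lop a g p + g p * Lop a f p
      + 2 * bil (a p) (fun j => pd j f p) (fun j => pd j g p) := by
  have h2 : ∀ j k, pd2 j k (fun p => f p * g p) p =
      f p * pd2 j k g p + g p * pd2 j k f p + pd j f p * pd k g p + pd k f p * pd j g p := by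
    intro j k
    simp only [pd2]
    rw [pd_mul hf hg, pd_add (hf.mul (hg.pd k)) ((hf.pd k).mul hg), pd_mul hf (hg.pd k),
      pd_mul (hf.pd k) hg]
    ring
  have h3 : ∑ j, ∑ k, a p j k * (pd k f p * pd j g p) = bil (a p) (fun j => pd j f p) (fun j => pd j g p) := by
    rw [bil, Finset.sum_comm]
    refine Finset.sum_congr rfl fun j _ => Finset.sum_congr rfl fun k _ => by rw [hs k j]; ring
  have h4 : ∑ j, ∑ k, a p j k * (pd j f p * pd k g p) = bil (a p) (fun j => pd j f p) (fun j => pd j g p) := by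
    rw [bil]
    refine Finset.sum_congr rfl fun j _ => Finset.sum_congr rfl fun k _ => by ring
  have h5 : ∑ j, ∑ k, a p j k * (f p * pd2 j k g p) = f p * ∑ j, ∑ k, a p j k * pd2 j k g p := by
    simp only [Finset.mul_sum]
    refine Finset.sum_congr rfl fun j _ => Finset.sum_congr rfl fun k _ => by ring
  have h6 : ∑ j, ∑ k, a p j k * (g p * pd2 j k f p) = g p * ∑ j, ∑ k, a p j k * pd2 j k f p := by
    simp only [Finset.mul_sum]
    refine Finset.sum_congr rfl fun j _ => Finset.sum_congr rfl fun k _ => by ring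
  simp only [Lop, h2, pt_mul hf hg, mul_add, Finset.sum_add_distrib, h3, h4, h5, h6]
  ring

lemma Lop_const_mul {d : ℕ} (a : ℝ × (Fin d → ℝ) → Fin d → Fin d → ℝ) {g : ℝ × (Fin d → ℝ) → ℝ}
    (hg : Sm g) (c : ℝ) (p : ℝ × (Fin d → ℝ)) (hs : ∀ j k, a p j k = a p k j) :
    Lop a (fun p => c * g p) p = c * Lop a g p := by
  rw [Lop_mul a contDiff_const hg p hs]
  simp [Lop, pd2, pd_const, pt_const, bil]

/-- the polynomial `c₀ + c₁ t + c₂ |x|²` -/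
def qpol (d : ℕ) (c₀ c₁ c₂ : ℝ) : ℝ × (Fin d → ℝ) → ℝ :=
  fun p => c₀ + c₁ * p.1 + c₂ * ∑ j, p.2 j ^ 2

lemma qpol_sm (d : ℕ) (c₀ c₁ c₂ : ℝ) : Sm (qpol d c₀ c₁ c₂) := by
  unfold Sm qpol; fun_prop

lemma qpol_pd {d : ℕ} (c₀ c₁ c₂ : ℝ) (j : Fin d) :
    pd j (qpol d c₀ c₁ c₂) = fun p => c₂ * (2 * p.2 j) := by
  ext p
  have h : HasDerivAt (fun s => ∑ i, (Function.update p.2 j s) i ^ 2) (2 * p.2 j) (p.2 j) := by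
    have : ∀ i ∈ Finset.univ, HasDerivAt (fun s => (Function.update p.2 j s) i ^ 2)
        (if i = j then 2 * p.2 j else 0) (p.2 j) := by
      intro i _
      by_cases hi : i = j
      · subst hi
        simpa using hasDerivAt_pow 2 (p.2 i)
      · simpa [hi] using hasDerivAt_const (p.2 j) (p.2 i ^ 2)
    simpa using HasDerivAt.fun_sum this
  exact ((h.const_mul c₂).const_add (c₀ + c₁ * p.1)).deriv

lemma qpol_pt {d : ℕ} (c₀ c₁ c₂ : ℝ) :
    pt (qpol d c₀ c₁ c₂) = fun _ => c₁ := by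
  ext p
  have := ((((hasDerivAt_id' p.1).const_mul c₁).const_add c₀).add_const (c₂ * ∑ j, p.2 j ^ 2)).deriv
  simpa [pt, qpol] using this

lemma qpol_pd2 {d : ℕ} (c₀ c₁ c₂ : ℝ) (j k : Fin d) (p : ℝ × (Fin d → ℝ)) :
    pd2 j k (qpol d c₀ c₁ c₂) p = if j = k then 2 * c₂ else 0 := by
  rw [pd2, qpol_pd, pd]
  by_cases h : j = k
  · subst h
    have := (((hasDerivAt_id' (p.2 j)).const_mul (2:ℝ)).const_mul c₂).deriv
    simp only [Function.update_self, if_true]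
    rw [this]; ring
  · have h' : k ≠ j := fun e => h e.symm
    simp [h, h']

lemma qpol_Lop {d : ℕ} (a : ℝ × (Fin d → ℝ) → Fin d → Fin d → ℝ) (c₀ c₁ c₂ : ℝ)
    (p : ℝ × (Fin d → ℝ)) :
    Lop a (qpol d c₀ c₁ c₂) p = -c₁ + 2 * c₂ * ∑ j, a p j j := by
  rw [Lop, qpol_pt]
  simp only [qpol_pd2, mul_ite, mul_zero, Finset.sum_ite_eq, Finset.mem_univ, if_true]
  rw [Finset.mul_sum]
  congr 1
  refine Finset.sum_congr rfl fun j _ => by ring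

lemma Elliptic.diag_le {d : ℕ} {δ : ℝ} {a : ℝ × (Fin d → ℝ) → Fin d → Fin d → ℝ}
    (h : Elliptic δ a) (p : ℝ × (Fin d → ℝ)) (j : Fin d) : δ ≤ a p j j ∧ a p j j ≤ δ⁻¹ := by
  have := (h p).2 (Pi.single j 1)
  simpa [Pi.single_apply, Finset.sum_ite_eq] using this

lemma Elliptic.tr_le {d : ℕ} {δ : ℝ} {a : ℝ × (Fin d → ℝ) → Fin d → Fin d → ℝ}
    (h : Elliptic δ a) (p : ℝ × (Fin d → ℝ)) : ∑ j, a p j j ≤ d * δ⁻¹ := by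
  have := Finset.sum_le_sum (fun j (_ : j ∈ Finset.univ) => (h.diag_le p j).2)
  simpa using this

/-- second derivative test for a p.s.d. matrix -/
lemma psd_decomp {d : ℕ} (A : Fin d → Fin d → ℝ) (hs : ∀ j k, A j k = A k j)
    (hp : ∀ ξ : Fin d → ℝ, 0 ≤ ∑ j, ∑ k, A j k * ξ j * ξ k) :
    ∃ m, ∃ B : Fin m → Fin d → ℝ, ∀ j k, A j k = ∑ i, B i j * B i k := by
  have hP : (Matrix.of A).PosSemidef := by
    refine Matrix.PosSemidef.of_dotProduct_mulVec_nonneg ?_ ?_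
    · ext j k; simp [hs j k]
    · intro ξ
      have := hp ξ
      simp only [dotProduct, Matrix.mulVec, Matrix.of_apply, Pi.star_apply, star_trivial]
      refine this.trans_eq ?_
      refine Finset.sum_congr rfl fun j _ => ?_
      rw [Finset.mul_sum]
      refine Finset.sum_congr rfl fun k _ => by ring
  obtain ⟨m, B, hB⟩ := Matrix.posSemidef_iff_eq_sum_vecMulVec.1 hP
  refine ⟨m, B, fun j k => ?_⟩
  have := congrFun (congrFun hB j) k
  simpa [Matrix.sum_apply, Matrix.vecMulVec_apply] using this

lemma max_Lop {d : ℕ} {a : ℝ × (Fin d → ℝ) → Fin d → Fin d → ℝ} {δ : ℝ} (hδ : 0 < δ)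
    (ha : Elliptic δ a) {F : ℝ × (Fin d → ℝ) → ℝ} (hF : Sm F) (p : ℝ × (Fin d → ℝ))
    (hmax : ∀ᶠ q in nhds p, q.1 ≤ p.1 → F q ≤ F p) : Lop a F p ≤ 0 := by
  obtain ⟨t, x⟩ := p
  have hx : Tendsto (fun s : ℝ => (s, x)) (nhds t) (nhds (t, x)) :=
    (Continuous.tendsto' (by fun_prop) _ _ rfl)
  have h1 : 0 ≤ pt F (t, x) := by
    refine first_test (tline hF t x) ?_
    have := (hx.eventually hmax).filter_mono (nhdsWithin_le_nhds (s := Iio t))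
    filter_upwards [this, self_mem_nhdsWithin] with s hs hst
    exact hs (le_of_lt hst)
  obtain ⟨m, B, hB⟩ := psd_decomp (a (t, x)) (ha _).1 (fun ξ => by
    refine le_trans ?_ ((ha (t, x)).2 ξ).1
    exact mul_nonneg hδ.le (Finset.sum_nonneg fun j _ => sq_nonneg _))
  have h2 : ∀ i, ∑ j, ∑ k, B i j * B i k * pd2 j k F (t, x) ≤ 0 := by
    intro i
    have h3 := sline2 hF t x (B i) 0
    have := second_test (sline hF t x (B i)) h3 (by
      have hl : Tendsto (fun s : ℝ => (t, x + s • B i)) (nhds 0) (nhds (t, x)) :=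
        (Continuous.tendsto' (by fun_prop) _ _ (by simp))
      filter_upwards [hl.eventually hmax] with s hs
      simpa using hs le_rfl)
    simpa using this
  have h4 : ∑ j, ∑ k, a (t, x) j k * pd2 j k F (t, x) =
      ∑ i, ∑ j, ∑ k, B i j * B i k * pd2 j k F (t, x) := by
    simp only [hB, Finset.sum_mul]
    rw [Finset.sum_congr rfl fun j (_ : j ∈ Finset.univ) => Finset.sum_comm]
    rw [Finset.sum_comm]
  have h5 : ∑ i, ∑ j, ∑ k, B i j * B i k * pd2 j k F (t, x) ≤ 0 :=
    Finset.sum_nonpos fun i _ => h2 i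
  rw [Lop, h4]; linarith

/-- Maximum principle -/
lemma max_principle {d : ℕ} {a : ℝ × (Fin d → ℝ) → Fin d → Fin d → ℝ} {δ : ℝ} (hδ : 0 < δ)
    (ha : Elliptic δ a) {F : ℝ × (Fin d → ℝ) → ℝ} (hF : Sm F) (K : Set (ℝ × (Fin d → ℝ)))
    (hK : IsCompact K) (m : ℝ)
    (h : ∀ p ∈ K, m < F p → (∀ᶠ q in nhds p, q.1 ≤ p.1 → q ∈ K) ∧ 0 < Lop a F p) :
    ∀ p ∈ K, F p ≤ m := by
  intro p0 hp0
  obtain ⟨p, hp, hpm⟩ := hK.exists_isMaxOn ⟨p0, hp0⟩ hF.continuous.continuousOn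
  refine (hpm hp0).trans ?_
  by_contra hc
  push Not at hc
  obtain ⟨h1, h2⟩ := h p hp hc
  have := max_Lop hδ ha hF p (by
    filter_upwards [h1] with q hq hqt
    exact hpm (hq hqt))
  linarith

/-! ### Bernstein estimates -/

def Om (d : ℕ) (s : ℝ) : Set (ℝ × (Fin d → ℝ)) := {p | p.1 < 0 ∧ ∑ j, p.2 j ^ 2 < s + p.1}

lemma Om_open (d : ℕ) (s : ℝ) : IsOpen (Om d s) := by
  have h1 : IsOpen {p : ℝ × (Fin d → ℝ) | p.1 < 0} :=
    isOpen_lt continuous_fst continuous_const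
  have h2 : IsOpen {p : ℝ × (Fin d → ℝ) | ∑ j, p.2 j ^ 2 < s + p.1} :=
    isOpen_lt (f := fun p : ℝ × (Fin d → ℝ) => ∑ j, p.2 j ^ 2)
      (g := fun p : ℝ × (Fin d → ℝ) => s + p.1) (by fun_prop) (by fun_prop)
  exact h1.inter h2

lemma Om_mono {d : ℕ} {s s' : ℝ} (h : s ≤ s') : Om d s ⊆ Om d s' := by
  rintro p ⟨h1, h2⟩; exact ⟨h1, by linarith⟩

def Ind {d : ℕ} (a : ℝ × (Fin d → ℝ) → Fin d → Fin d → ℝ) : Prop :=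
  ∀ (j k : Fin d) (t : ℝ) (x y : Fin d → ℝ),
    (∀ i : Fin d, (i : ℕ) < 2 → x i = y i) → a (t, x) j k = a (t, y) j k

lemma diff_eq {d : ℕ} {a : ℝ × (Fin d → ℝ) → Fin d → Fin d → ℝ} (hi : Ind a)
    {v : ℝ × (Fin d → ℝ) → ℝ} (hv : Sm v) {U : Set (ℝ × (Fin d → ℝ))} (hU : IsOpen U)
    (h : ∀ p ∈ U, Lop a v p = 0) (k : Fin d) (hk : 2 ≤ (k : ℕ)) :
    ∀ p ∈ U, Lop a (pd k v) p = 0 := by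
  rintro ⟨t, x⟩ hp
  have hline : ∀ f : ℝ × (Fin d → ℝ) → ℝ, Sm f →
      HasDerivAt (fun s : ℝ => f (t, x + s • (Pi.single k 1 : Fin d → ℝ))) (pd k f (t, x)) 0 := by
    intro f hf
    have := sline hf t x (Pi.single k 1) 0
    refine this.congr_deriv ?_
    simp [Pi.single_apply]
  have hD : HasDerivAt (fun s : ℝ => -(pt v (t, x + s • (Pi.single k 1 : Fin d → ℝ))) +
      ∑ i, ∑ j, a (t, x) i j * pd2 i j v (t, x + s • (Pi.single k 1 : Fin d → ℝ)))
      (-(pd k (pt v) (t, x)) + ∑ i, ∑ j, a (t, x) i j * pd k (pd2 i j v) (t, x)) 0 := by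
    apply HasDerivAt.fun_add
    · exact (hline _ hv.pt).fun_neg
    · apply HasDerivAt.fun_sum
      intro i _
      apply HasDerivAt.fun_sum
      intro j _
      exact (hline _ ((hv.pd j).pd i)).const_mul _
  have hl : Tendsto (fun s : ℝ => (t, x + s • (Pi.single k 1 : Fin d → ℝ))) (nhds 0) (nhds (t, x)) :=
    (Continuous.tendsto' (by fun_prop) _ _ (by simp))
  have h0 : (fun s : ℝ => -(pt v (t, x + s • (Pi.single k 1 : Fin d → ℝ))) +
      ∑ i, ∑ j, a (t, x) i j * pd2 i j v (t, x + s • (Pi.single k 1 : Fin d → ℝ))) =ᶠ[nhds 0]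
      fun _ => 0 := by
    filter_upwards [hl.eventually (hU.mem_nhds hp)] with s hs
    rw [← h _ hs, Lop]
    congr 1
    refine Finset.sum_congr rfl fun i _ => Finset.sum_congr rfl fun j _ => ?_
    rw [hi i j t x (x + s • (Pi.single k 1 : Fin d → ℝ))]
    intro l hl
    have : l ≠ k := by rintro rfl; omega
    simp [this]
  have h1 := hD.unique ((hasDerivAt_const (0:ℝ) (0:ℝ)).congr_of_eventuallyEq h0)
  rw [Lop, ← pd_pt_comm hv, ← h1]
  congr 1
  refine Finset.sum_congr rfl fun i _ => Finset.sum_congr rfl fun j _ => ?_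
  rw [pd2, pd2, pd_comm hv j k, pd_comm (hv.pd j) i k]

set_option maxHeartbeats 800000 in
lemma bern_est (d : ℕ) (δ : ℝ) (hδ : 0 < δ) (s : ℝ) (hs : 0 < s) (hs1 : s ≤ 1) :
    ∃ C : ℝ, 0 ≤ C ∧ ∀ (a : ℝ × (Fin d → ℝ) → Fin d → Fin d → ℝ), Elliptic δ a → Ind a →
      ∀ (v : ℝ × (Fin d → ℝ) → ℝ) (M : ℝ), Sm v → (∀ p ∈ Om d s, Lop a v p = 0) →
      (∀ p ∈ Om d s, |v p| ≤ M) → ∀ k : Fin d, 2 ≤ (k : ℕ) →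
      ∀ p ∈ Om d (s / 2), |pd k v p| ≤ C * M := by
  set K : ℝ := (2 + 2 * d * δ⁻¹ + 12 * δ⁻¹) * δ⁻¹ with hKdef
  have hδi : 0 < δ⁻¹ := inv_pos.2 hδ
  have hKδ : K * δ = 2 + 2 * d * δ⁻¹ + 12 * δ⁻¹ := by rw [hKdef]; field_simp
  have hK0 : 0 ≤ K := by positivity
  refine ⟨4 * √K / s, by positivity, ?_⟩
  intro a ha hi v M hv hL hM k hk p0 hp0
  have hp0s : p0 ∈ Om d s := Om_mono (by linarith) hp0
  have hM0 : 0 ≤ M := (abs_nonneg _).trans (hM _ hp0s)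
  set w := pd k v with hw
  have hwS : Sm w := hv.pd k
  have hLw := diff_eq hi hv (Om_open d s) hL k hk
  set ζ := qpol d (3 / 4 * s) 1 (-1) with hζ
  have hζS : Sm ζ := qpol_sm _ _ _ _
  set G : ℝ × (Fin d → ℝ) → ℝ := fun p => (ζ p * w p) * (ζ p * w p) + K * (v p * v p) with hG
  have hGS : Sm G := ((hζS.mul hwS).mul (hζS.mul hwS)).add (contDiff_const.mul (hv.mul hv))
  set Ks : Set (ℝ × (Fin d → ℝ)) := {q | q.1 ≤ p0.1 ∧ 0 ≤ ζ q} with hKs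
  have hKsub : Ks ⊆ Om d s := by
    rintro q ⟨h1, h2⟩
    simp only [hζ, qpol] at h2
    exact ⟨lt_of_le_of_lt h1 hp0.1, by linarith⟩
  have hKc : IsCompact Ks := by
    refine IsCompact.of_isClosed_subset
      (isCompact_Icc (a := ((-1 : ℝ), (fun _ => -1 : Fin d → ℝ))) (b := ((1:ℝ), (fun _ => 1 : Fin d → ℝ)))) ?_ ?_
    · exact (isClosed_le continuous_fst continuous_const).inter
        (isClosed_le continuous_const hζS.continuous)
    · intro q hq
      obtain ⟨h1, h2⟩ := hKsub hq
      have hsum : ∀ j, q.2 j ^ 2 ≤ 1 := fun j => by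
        have := Finset.single_le_sum (f := fun j => q.2 j ^ 2) (fun i _ => sq_nonneg _) (Finset.mem_univ j)
        linarith
      have hnn : 0 ≤ ∑ j, q.2 j ^ 2 := Finset.sum_nonneg fun i _ => sq_nonneg _
      refine ⟨⟨by simp; linarith, fun j => ?_⟩, ⟨by simp; linarith, fun j => ?_⟩⟩
      · exact (abs_le.1 (sq_le_one_iff_abs_le_one _ |>.1 (hsum j))).1
      · exact (abs_le.1 (sq_le_one_iff_abs_le_one _ |>.1 (hsum j))).2
  have key := max_principle hδ ha hGS Ks hKc (K * M ^ 2) (by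
    intro q hq hGq
    have hqs := hKsub hq
    have hvq : v q * v q ≤ M ^ 2 := by
      have := hM q hqs
      rw [← pow_two]; exact sq_le_sq' (abs_le.1 this).1 (abs_le.1 this).2
    have hne : ζ q * w q ≠ 0 := by
      intro h0
      simp only [hG, h0] at hGq
      nlinarith
    have hζpos : 0 < ζ q := lt_of_le_of_ne hq.2 (fun h => hne (by rw [← h]; ring))
    have hwne : w q ≠ 0 := fun h => hne (by rw [h]; ring)
    refine ⟨?_, ?_⟩
    · filter_upwards [hζS.continuous.continuousAt.eventually (lt_mem_nhds hζpos)] with q' hq' hqt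
      exact ⟨hqt.trans hq.1, le_of_lt hq'⟩
    · have hsy := (ha q).1
      have e1 : Lop a G q = (ζ q * w q) * Lop a (fun p => ζ p * w p) q
          + (ζ q * w q) * Lop a (fun p => ζ p * w p) q
          + 2 * bil (a q) (fun j => pd j (fun p => ζ p * w p) q) (fun j => pd j (fun p => ζ p * w p) q)
          + K * (v q * Lop a v q + v q * Lop a v q
            + 2 * bil (a q) (fun j => pd j v q) (fun j => pd j v q)) := by
        rw [hG, Lop_add a ((hζS.mul hwS).mul (hζS.mul hwS)) (contDiff_const.mul (hv.mul hv)),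
          Lop_const_mul a (hv.mul hv) _ _ hsy, Lop_mul a hv hv _ hsy,
          Lop_mul a (hζS.mul hwS) (hζS.mul hwS) _ hsy]
      have e2 := Lop_mul a hζS hwS q hsy
      rw [hLw q hqs] at e2
      set Dζ : Fin d → ℝ := fun j => pd j ζ q
      set Dw : Fin d → ℝ := fun j => pd j w q
      have e3 : (fun j => pd j (fun p => ζ p * w p) q) = fun j => ζ q * Dw j + w q * Dζ j := by
        funext j
        rw [pd_mul hζS hwS]
        simp only [Dζ, Dw]; ring
      have bb : ∀ α β : ℝ, bil (a q) (fun j => α * Dw j + β * Dζ j) (fun j => α * Dw j + β * Dζ j)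
          = α ^ 2 * bil (a q) Dw Dw + 2 * α * β * bil (a q) Dζ Dw + β ^ 2 * bil (a q) Dζ Dζ := by
        intro α β
        rw [bil_add_left (a q) (fun j => α * Dw j) (fun j => β * Dζ j), bil_smul_left, bil_smul_left,
          bil_symm _ hsy Dw, bil_symm _ hsy Dζ (fun j => α * Dw j + β * Dζ j),
          bil_add_left (a q) (fun j => α * Dw j) (fun j => β * Dζ j),
          bil_add_left (a q) (fun j => α * Dw j) (fun j => β * Dζ j),
          bil_smul_left, bil_smul_left, bil_smul_left, bil_smul_left, bil_symm _ hsy Dw Dζ]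
        ring
      have pos : ∀ ξ, δ * ∑ j, ξ j ^ 2 ≤ bil (a q) ξ ξ := fun ξ => ((ha q).2 ξ).1
      have pos' : ∀ ξ, 0 ≤ bil (a q) ξ ξ := fun ξ =>
        le_trans (mul_nonneg hδ.le (Finset.sum_nonneg fun i _ => sq_nonneg _)) (pos ξ)
      have e4 := pos' (fun j => ζ q * Dw j + (2 * w q) * Dζ j)
      rw [bb] at e4
      have e5 : δ * w q ^ 2 ≤ bil (a q) (fun j => pd j v q) (fun j => pd j v q) := by
        refine le_trans ?_ (pos _)
        refine mul_le_mul_of_nonneg_left ?_ hδ.le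
        exact Finset.single_le_sum (f := fun j => (pd j v q) ^ 2) (fun i _ => sq_nonneg _) (Finset.mem_univ k)
      have hnn : 0 ≤ ∑ j, q.2 j ^ 2 := Finset.sum_nonneg fun i _ => sq_nonneg _
      have e6 : bil (a q) Dζ Dζ ≤ 4 * δ⁻¹ := by
        refine ((ha q).2 Dζ).2.trans ?_
        have : ∑ j, Dζ j ^ 2 = 4 * ∑ j, q.2 j ^ 2 := by
          rw [Finset.mul_sum]
          refine Finset.sum_congr rfl fun j _ => ?_
          simp only [Dζ, hζ, qpol_pd]; ring
        rw [this]
        have := hqs.2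
        have h1 := hqs.1
        nlinarith
      have e7 : -(1 + 2 * d * δ⁻¹) ≤ Lop a ζ q := by
        rw [hζ, qpol_Lop]
        have := ha.tr_le q
        linarith
      have hζ1 : ζ q ≤ 1 := by
        simp only [hζ, qpol]
        have h1 := hqs.1
        linarith
      have e8 : -(1 + 2 * d * δ⁻¹) ≤ ζ q * Lop a ζ q := by
        have h9 : 0 ≤ (1 + 2 * d * δ⁻¹) := by positivity
        nlinarith
      have hw2 : 0 < w q ^ 2 := by positivity
      rw [e1, e2, e3, bb, hL q hqs]
      have f1 : w q ^ 2 * (-(1 + 2 * d * δ⁻¹)) ≤ w q ^ 2 * (ζ q * Lop a ζ q) :=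
        mul_le_mul_of_nonneg_left e8 hw2.le
      have f2 : w q ^ 2 * bil (a q) Dζ Dζ ≤ w q ^ 2 * (4 * δ⁻¹) :=
        mul_le_mul_of_nonneg_left e6 hw2.le
      have f3 : K * (δ * w q ^ 2) ≤ K * bil (a q) (fun j => pd j v q) (fun j => pd j v q) :=
        mul_le_mul_of_nonneg_left e5 hK0
      have f4 : K * (δ * w q ^ 2) = (2 + 2 * d * δ⁻¹ + 12 * δ⁻¹) * w q ^ 2 := by
        rw [← hKδ]; ring
      linarith [f1, f2, f3, f4, e4, hw2])
  have hζp : s / 4 ≤ ζ p0 := by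
    have := hp0.2
    simp only [hζ, qpol]; linarith
  have h1 := key p0 ⟨le_rfl, by linarith⟩
  simp only [hG] at h1
  have h2 : (ζ p0 * w p0) ^ 2 ≤ (√K * M) ^ 2 := by
    rw [mul_pow √K, Real.sq_sqrt hK0]
    nlinarith [mul_nonneg hK0 (mul_self_nonneg (v p0))]
  have h3 := abs_le_of_sq_le_sq h2 (by positivity)
  have h4 : |ζ p0 * w p0| ≤ √K * M := h3
  rw [abs_mul, abs_of_pos (by linarith : 0 < ζ p0)] at h4
  have h5 : s / 4 * |w p0| ≤ √K * M := le_trans (mul_le_mul_of_nonneg_right hζp (abs_nonneg _)) h4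
  have : |w p0| = (s / 4 * |w p0|) * (4 / s) := by field_simp
  rw [this]
  calc _ ≤ (√K * M) * (4 / s) := mul_le_mul_of_nonneg_right h5 (by positivity)
    _ = _ := by ring

/-! ### The coupling matrices -/

lemma sgn_choice (α α' β β' : ℝ) (h : α ^ 2 + α' ^ 2 = β ^ 2 + β' ^ 2) :
    ∃ σ : ℝ, σ ^ 2 = 1 ∧ 0 ≤ (α - σ * β) ^ 2 - (α' - σ * β') ^ 2 := by
  by_cases h1 : 0 ≤ (α - β) ^ 2 - (α' - β') ^ 2
  · exact ⟨1, by norm_num, by simpa using h1⟩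
  · refine ⟨-1, by norm_num, ?_⟩
    push Not at h1
    by_contra h2
    push Not at h2
    have h3 : 0 < ((α - β) ^ 2 - (α' - β') ^ 2) * ((α - (-1) * β) ^ 2 - (α' - (-1) * β') ^ 2) :=
      mul_pos_of_neg_of_neg h1 h2
    have h4 : ((α - β) ^ 2 - (α' - β') ^ 2) * ((α - (-1) * β) ^ 2 - (α' - (-1) * β') ^ 2)
        = -4 * (α * α' - β * β') ^ 2 := by
      have : α' ^ 2 = β ^ 2 + β' ^ 2 - α ^ 2 := by linarith
      have e : ((α - β) ^ 2 - (α' - β') ^ 2) * ((α - (-1) * β) ^ 2 - (α' - (-1) * β') ^ 2)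
        = (α ^ 2 + β ^ 2 - α' ^ 2 - β' ^ 2) ^ 2 - 4 * (α * β - α' * β') ^ 2 := by ring
      rw [e]
      have e2 : (α * β - α' * β') ^ 2 = α ^ 2 * β ^ 2 + α' ^ 2 * β' ^ 2 - 2 * α * β * α' * β' := by ring
      have e3 : (α * α' - β * β') ^ 2 = α ^ 2 * α' ^ 2 + β ^ 2 * β' ^ 2 - 2 * α * β * α' * β' := by ring
      rw [e2, e3, this]; ring
    nlinarith [sq_nonneg (α * α' - β * β')]

lemma balanced (A B C : ℝ) (h : ∀ x y : ℝ, 0 ≤ A * x ^ 2 + 2 * B * x * y + C * y ^ 2) :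
    ∃ p p' q q' : ℝ, p ^ 2 + q ^ 2 = A ∧ p * p' + q * q' = B ∧ p' ^ 2 + q' ^ 2 = C ∧
      p ^ 2 + p' ^ 2 = (A + C) / 2 ∧ q ^ 2 + q' ^ 2 = (A + C) / 2 := by
  have hdet : B ^ 2 ≤ A * C := by
    have := discrim_le_zero (a := A) (b := 2 * B) (c := C) (fun x => by
      have := h x 1
      nlinarith)
    rw [discrim] at this
    nlinarith
  have hA : 0 ≤ A := by have := h 1 0; linarith
  have hC : 0 ≤ C := by have := h 0 1; linarith
  set z : ℂ := ⟨(A - C) / 2, B⟩ with hz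
  set μ := ‖z‖ with hμ
  set φ := z.arg with hφ
  have h1 : μ * cos φ = (A - C) / 2 := Complex.norm_mul_cos_arg z
  have h2 : μ * sin φ = B := Complex.norm_mul_sin_arg z
  have hμ0 : 0 ≤ μ := norm_nonneg z
  have hμ2 : μ ^ 2 = ((A - C) / 2) ^ 2 + B ^ 2 := by
    rw [← h1, ← h2]; nlinarith [sin_sq_add_cos_sq φ]
  have hμT : μ ≤ (A + C) / 2 := by
    apply le_of_sq_le_sq _ (by linarith)
    rw [hμ2]; nlinarith
  set c := cos (φ / 2)
  set s := sin (φ / 2)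
  have hc : cos φ = c ^ 2 - s ^ 2 := by
    rw [← cos_two_mul']; congr 1; ring
  have hs : sin φ = 2 * s * c := by
    rw [← sin_two_mul]; congr 1; ring
  have hcs : s ^ 2 + c ^ 2 = 1 := sin_sq_add_cos_sq _
  set l := √(((A + C) / 2 + μ) / 2)
  set m := √(((A + C) / 2 - μ) / 2)
  have hl : l ^ 2 = ((A + C) / 2 + μ) / 2 := Real.sq_sqrt (by linarith)
  have hm : m ^ 2 = ((A + C) / 2 - μ) / 2 := Real.sq_sqrt (by linarith)
  rw [hc] at h1
  rw [hs] at h2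
  refine ⟨l * c - m * s, l * s + m * c, l * c + m * s, l * s - m * c, ?_, ?_, ?_, ?_, ?_⟩
  · have : (l * c - m * s) ^ 2 + (l * c + m * s) ^ 2 = 2 * (l ^ 2 * c ^ 2 + m ^ 2 * s ^ 2) := by ring
    rw [this, hl, hm]
    linear_combination (A + C) / 2 * hcs + h1
  · have : (l * c - m * s) * (l * s + m * c) + (l * c + m * s) * (l * s - m * c)
      = 2 * (l ^ 2 - m ^ 2) * (s * c) := by ring
    rw [this, hl, hm]
    linear_combination h2
  · have : (l * s + m * c) ^ 2 + (l * s - m * c) ^ 2 = 2 * (l ^ 2 * s ^ 2 + m ^ 2 * c ^ 2) := by ring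
    rw [this, hl, hm]
    linear_combination (A + C) / 2 * hcs - h1
  · have : (l * c - m * s) ^ 2 + (l * s + m * c) ^ 2 = (l ^ 2 + m ^ 2) * (s ^ 2 + c ^ 2) := by ring
    rw [this, hl, hm, hcs]; ring
  · have : (l * c + m * s) ^ 2 + (l * s - m * c) ^ 2 = (l ^ 2 + m ^ 2) * (s ^ 2 + c ^ 2) := by ring
    rw [this, hl, hm, hcs]; ring

def mk2 {d : ℕ} (a b : ℝ) (c : Fin d → ℝ) : Fin d → ℝ :=
  fun j => if (j : ℕ) = 0 then a else if (j : ℕ) = 1 then b else c j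

/-- ellipticity of a single matrix -/
def EllM {d : ℕ} (δ : ℝ) (A : Fin d → Fin d → ℝ) : Prop :=
  (∀ j k, A j k = A k j) ∧
    ∀ ξ : Fin d → ℝ, δ * (∑ j, ξ j ^ 2) ≤ ∑ j, ∑ k, A j k * ξ j * ξ k ∧
      ∑ j, ∑ k, A j k * ξ j * ξ k ≤ δ⁻¹ * (∑ j, ξ j ^ 2)

lemma EllM.two {d : ℕ} {δ : ℝ} {A : Fin d → Fin d → ℝ} (h : EllM δ A) {i j : Fin d} (hij : i ≠ j)
    (x y : ℝ) : δ * (x ^ 2 + y ^ 2) ≤ A i i * x ^ 2 + 2 * A i j * x * y + A j j * y ^ 2 ∧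
      A i i * x ^ 2 + 2 * A i j * x * y + A j j * y ^ 2 ≤ δ⁻¹ * (x ^ 2 + y ^ 2) := by
  have := h.2 (fun k => (if k = i then x else 0) + (if k = j then y else 0))
  have e1 : ∑ k, ((if k = i then x else 0) + (if k = j then y else 0)) ^ 2 = x ^ 2 + y ^ 2 := by
    have : ∀ k, ((if k = i then x else 0) + (if k = j then y else 0)) ^ 2
        = (if k = i then x ^ 2 else 0) + (if k = j then y ^ 2 else 0) := by
      intro k
      by_cases h1 : k = i
      · have : k ≠ j := fun h2 => hij (h1.symm.trans h2)
        simp [h1, hij]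
      · simp [h1]
    simp [this, Finset.sum_add_distrib]
  have e2 : ∑ k, ∑ l, A k l * ((if k = i then x else 0) + (if k = j then y else 0)) *
      ((if l = i then x else 0) + (if l = j then y else 0)) =
      A i i * x ^ 2 + 2 * A i j * x * y + A j j * y ^ 2 := by
    simp only [mul_add, add_mul, Finset.sum_add_distrib, mul_ite, ite_mul, mul_zero, zero_mul,
      Finset.sum_ite_eq', Finset.mem_univ, if_true]
    rw [h.1 j i]; ring
  rwa [e1, e2] at this

lemma EllM.abs_le {d : ℕ} {δ : ℝ} (hδ : 0 < δ) {A : Fin d → Fin d → ℝ} (h : EllM δ A) {i j : Fin d}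
    (hij : i ≠ j) : |A i j| ≤ δ⁻¹ := by
  have h1 := h.two hij 1 1
  have h2 := h.two hij 1 (-1)
  have h3 := h.two hij 1 0
  have h4 := h.two hij 0 1
  rw [_root_.abs_le]
  constructor <;> nlinarith

lemma EllM.diag {d : ℕ} {δ : ℝ} {A : Fin d → Fin d → ℝ} (h : EllM δ A) (j : Fin d) :
    A j j ≤ δ⁻¹ := by
  have := h.2 (Pi.single j 1)
  have := this.2
  simpa [Pi.single_apply, Finset.sum_ite_eq] using this

set_option maxHeartbeats 1000000 in
lemma coupling {d : ℕ} {δ : ℝ} (hδ : 0 < δ) (A C : Fin d → Fin d → ℝ) (hA : EllM δ A)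
    (hC : EllM δ C) (i0 i1 : Fin d) (hi0 : (i0 : ℕ) = 0) (hi1 : (i1 : ℕ) = 1)
    (htr : A i0 i0 + A i1 i1 = C i0 i0 + C i1 i1) (e e' : ℝ) (he : e ^ 2 + e' ^ 2 = 1) :
    ∃ X Y : Fin 8 → Fin d → ℝ,
      (∀ (i : Fin 8) (k : Fin d), 2 ≤ (k : ℕ) → X i k = Y i k) ∧
      (∀ j k : Fin d, (j : ℕ) < 2 → ∑ i, X i j * X i k = A j k) ∧
      (∀ j k : Fin d, (j : ℕ) < 2 → ∑ i, Y i j * Y i k = C j k) ∧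
      (∀ j k : Fin d, 2 ≤ (j : ℕ) → 2 ≤ (k : ℕ) → |∑ i, X i j * X i k| ≤ 8 * δ⁻¹ ^ 3) ∧
      2 * δ ≤ ∑ i, (e * (X i i0 - Y i i0) + e' * (X i i1 - Y i i1)) ^ 2
        - ∑ i, (-e' * (X i i0 - Y i i0) + e * (X i i1 - Y i i1)) ^ 2 := by
  have hne : i0 ≠ i1 := by intro h; rw [h] at hi0; omega
  obtain ⟨p, p', q, q', hp1, hp2, hp3, hp4, hp5⟩ := balanced (A i0 i0 - δ) (A i0 i1) (A i1 i1 - δ)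
    (fun x y => by have := (hA.two hne x y).1; linarith)
  obtain ⟨s, s', r, r', hs1, hs2, hs3, hs4, hs5⟩ := balanced (C i0 i0 - δ) (C i0 i1) (C i1 i1 - δ)
    (fun x y => by have := (hC.two hne x y).1; linarith)
  obtain ⟨σ, hσ, hσ'⟩ := sgn_choice (e * p + e' * p') (-e' * p + e * p') (e * s + e' * s')
    (-e' * s + e * s') (by
      have : ∀ p p', (e * p + e' * p') ^ 2 + (-e' * p + e * p') ^ 2 = (e ^ 2 + e' ^ 2) * (p ^ 2 + p' ^ 2) := by
        intros; ring
      rw [this, this, he]; linarith)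
  obtain ⟨τ, hτ, hτ'⟩ := sgn_choice (e * q + e' * q') (-e' * q + e * q') (e * r + e' * r')
    (-e' * r + e * r') (by
      have : ∀ p p', (e * p + e' * p') ^ 2 + (-e' * p + e * p') ^ 2 = (e ^ 2 + e' ^ 2) * (p ^ 2 + p' ^ 2) := by
        intros; ring
      rw [this, this, he]; linarith)
  set k := √(δ / 2) with hk
  have hk2 : k * k = δ / 2 := Real.mul_self_sqrt (by positivity)
  have hk0 : 0 < k := Real.sqrt_pos.2 (by positivity)
  have hkk : k * k⁻¹ = 1 := mul_inv_cancel₀ hk0.ne'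
  have hki : k⁻¹ * k⁻¹ = 2 * δ⁻¹ := by
    rw [← mul_inv, hk2]; field_simp
  have hAs := hA.1 i1 i0
  have hCs := hC.1 i1 i0
  have cases2 : ∀ j : Fin d, (j : ℕ) < 2 → j = i0 ∨ j = i1 := by
    intro j hj
    have : (j : ℕ) = 0 ∨ (j : ℕ) = 1 := by omega
    rcases this with h | h
    · left; ext; omega
    · right; ext; omega
  have hc0 : ∀ l : Fin d, 2 ≤ (l : ℕ) → (l : ℕ) ≠ 0 := fun l h => by omega
  have hc1 : ∀ l : Fin d, 2 ≤ (l : ℕ) → (l : ℕ) ≠ 1 := fun l h => by omega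
  refine ⟨![mk2 (k * e) (k * e') 0, mk2 (-(k * e')) (k * e) 0, mk2 p p' 0, mk2 q q' 0,
      mk2 k 0 (fun l => k⁻¹ * A i0 l), mk2 0 k (fun l => k⁻¹ * A i1 l),
      mk2 0 0 (fun l => k⁻¹ * C i0 l), mk2 0 0 (fun l => k⁻¹ * C i1 l)],
    ![mk2 (-(k * e)) (-(k * e')) 0, mk2 (-(k * e')) (k * e) 0, mk2 (σ * s) (σ * s') 0,
      mk2 (τ * r) (τ * r') 0,
      mk2 0 0 (fun l => k⁻¹ * A i0 l), mk2 0 0 (fun l => k⁻¹ * A i1 l),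
      mk2 k 0 (fun l => k⁻¹ * C i0 l), mk2 0 k (fun l => k⁻¹ * C i1 l)], ?_, ?_, ?_, ?_, ?_⟩
  · intro i l hl
    fin_cases i <;> simp [mk2, hc0 l hl, hc1 l hl]
  · intro j l hj
    simp only [Fin.sum_univ_eight, Matrix.cons_val]
    by_cases hl : (l : ℕ) < 2
    · rcases cases2 j hj with rfl | rfl <;> rcases cases2 l hl with rfl | rfl <;>
        simp only [mk2, hi0, hi1, if_true, one_ne_zero, if_false]
      · linear_combination hp1 + 2 * hk2 + k * k * he
      · linear_combination hp2
      · linear_combination hp2 - hAs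
      · linear_combination hp3 + 2 * hk2 + k * k * he
    · push Not at hl
      rcases cases2 j hj with rfl | rfl <;>
        simp only [mk2, hi0, hi1, if_true, one_ne_zero, if_false, hc0 l hl, hc1 l hl, Pi.zero_apply]
      · linear_combination A j l * hkk
      · linear_combination A j l * hkk
  · intro j l hj
    simp only [Fin.sum_univ_eight, Matrix.cons_val]
    by_cases hl : (l : ℕ) < 2
    · rcases cases2 j hj with rfl | rfl <;> rcases cases2 l hl with rfl | rfl <;>
        simp only [mk2, hi0, hi1, if_true, one_ne_zero, if_false]
      · linear_combination hs1 + 2 * hk2 + k * k * he + s ^ 2 * hσ + r ^ 2 * hτ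
      · linear_combination hs2 + s * s' * hσ + r * r' * hτ
      · linear_combination hs2 - hCs + s * s' * hσ + r * r' * hτ
      · linear_combination hs3 + 2 * hk2 + k * k * he + s' ^ 2 * hσ + r' ^ 2 * hτ
    · push Not at hl
      rcases cases2 j hj with rfl | rfl <;>
        simp only [mk2, hi0, hi1, if_true, one_ne_zero, if_false, hc0 l hl, hc1 l hl, Pi.zero_apply]
      · linear_combination C j l * hkk
      · linear_combination C j l * hkk
  · intro j l hj hl
    simp only [Fin.sum_univ_eight, Matrix.cons_val]
    simp only [mk2, if_false, hc0 l hl, hc1 l hl, hc0 j hj, hc1 j hj, Pi.zero_apply]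
    have nn : ∀ m : Fin d, 2 ≤ (m : ℕ) → i0 ≠ m ∧ i1 ≠ m := fun m hm =>
      ⟨by rintro rfl; omega, by rintro rfl; omega⟩
    have b : ∀ x y : ℝ, |x| ≤ δ⁻¹ → |y| ≤ δ⁻¹ → |k⁻¹ * x * (k⁻¹ * y)| ≤ 2 * δ⁻¹ ^ 3 := by
      intro x y hx hy
      have : k⁻¹ * x * (k⁻¹ * y) = 2 * δ⁻¹ * (x * y) := by rw [← hki]; ring
      rw [this, abs_mul, abs_mul x y, abs_of_pos (by positivity : 0 < 2 * δ⁻¹)]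
      have := mul_le_mul hx hy (abs_nonneg _) (by positivity)
      calc 2 * δ⁻¹ * (|x| * |y|) ≤ 2 * δ⁻¹ * (δ⁻¹ * δ⁻¹) := by gcongr
        _ = _ := by ring
    have b1 := abs_le.1 (b _ _ (hA.abs_le hδ (nn j hj).1) (hA.abs_le hδ (nn l hl).1))
    have b2 := abs_le.1 (b _ _ (hA.abs_le hδ (nn j hj).2) (hA.abs_le hδ (nn l hl).2))
    have b3 := abs_le.1 (b _ _ (hC.abs_le hδ (nn j hj).1) (hC.abs_le hδ (nn l hl).1))
    have b4 := abs_le.1 (b _ _ (hC.abs_le hδ (nn j hj).2) (hC.abs_le hδ (nn l hl).2))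
    rw [abs_le]
    constructor <;> linarith [b1.1, b1.2, b2.1, b2.2, b3.1, b3.2, b4.1, b4.2]
  · simp only [Fin.sum_univ_eight, Matrix.cons_val]
    simp only [mk2, hi0, hi1, if_true, one_ne_zero, if_false]
    have key : (e * (k * e - -(k * e)) + e' * (k * e' - -(k * e'))) ^ 2 = 2 * δ := by
      have : (e * (k * e - -(k * e)) + e' * (k * e' - -(k * e'))) ^ 2
        = 4 * (k * k) * (e ^ 2 + e' ^ 2) ^ 2 := by ring
      rw [this, he, hk2]; ring
    have key2 : (-e' * (k * e - -(k * e)) + e * (k * e' - -(k * e'))) ^ 2 = 0 := by ring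
    rw [key, key2]
    ring_nf at hσ' hτ' ⊢
    linarith

/-! ### Coupling: tools -/

lemma second_test' {g g' : ℝ → ℝ} {g2 : ℝ} (h1 : ∀ᶠ s in nhds 0, HasDerivAt g (g' s) s)
    (h2 : HasDerivAt g' g2 0) (hmax : IsLocalMax g 0) : g2 ≤ 0 := by
  by_contra hc
  push Not at hc
  have hd : deriv g =ᶠ[nhds 0] g' := by
    filter_upwards [h1] with s hs using hs.deriv
  have h0 : deriv g 0 = 0 := hmax.deriv_eq_zero
  have hg0 : g' 0 = 0 := by rw [← hd.self_of_nhds, h0]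
  have hder : ∀ᶠ s in nhdsWithin (0:ℝ) (Ioi 0), 0 < g' s := by
    have h3 := hasDerivAt_iff_tendsto_slope.1 h2
    have h4 := (h3.eventually (lt_mem_nhds hc)).filter_mono
      (nhdsWithin_mono 0 (fun s (hs : s ∈ Ioi (0:ℝ)) => ne_of_gt hs))
    filter_upwards [h4, self_mem_nhdsWithin] with s hs hs0
    rw [slope_def_field, hg0] at hs
    have hs0' : (0:ℝ) < s := hs0
    have := mul_pos hs hs0'
    simpa [hs0'.ne'] using this
  obtain ⟨ε, hε, hε1⟩ := Metric.eventually_nhds_iff.1 (h1.and hmax)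
  obtain ⟨b, hb, hb1⟩ := mem_nhdsGT_iff_exists_Ioo_subset.1 hder
  have hb0 : (0:ℝ) < b := hb
  set c := min ε b / 2 with hcdef
  have hc0 : 0 < c := by positivity
  have hcε : c < ε := by have := min_le_left ε b; have := lt_min hε hb0; linarith
  have hcb : c < b := by have := min_le_right ε b; have := lt_min hε hb0; linarith
  have hin : ∀ s, 0 ≤ s → s ≤ c → dist s 0 < ε := by
    intro s h1 h2
    rw [Real.dist_eq, sub_zero, abs_of_nonneg h1]; linarith
  have hmono : StrictMonoOn g (Icc 0 c) := by
    apply strictMonoOn_of_deriv_pos (convex_Icc 0 c)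
    · intro s hs
      exact (hε1 (hin s hs.1 hs.2)).1.continuousAt.continuousWithinAt
    · intro s hs
      rw [interior_Icc] at hs
      rw [(hε1 (hin s hs.1.le hs.2.le)).1.deriv]
      exact hb1 ⟨hs.1, hs.2.trans hcb⟩
  have h5 := hmono ⟨le_rfl, hc0.le⟩ ⟨hc0.le, le_rfl⟩ hc0
  have h6 := (hε1 (hin c hc0.le le_rfl)).2
  linarith

lemma rpow_line (z z' w w' β : ℝ) (hq : 0 < z ^ 2 + z' ^ 2) :
    (∀ᶠ s in nhds (0:ℝ), HasDerivAt (fun s : ℝ => ((z + s * w) ^ 2 + (z' + s * w') ^ 2) ^ β)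
      ((2 * (z + s * w) * w + 2 * (z' + s * w') * w') * β *
        ((z + s * w) ^ 2 + (z' + s * w') ^ 2) ^ (β - 1)) s) ∧
    HasDerivAt (fun s : ℝ => (2 * (z + s * w) * w + 2 * (z' + s * w') * w') * β *
        ((z + s * w) ^ 2 + (z' + s * w') ^ 2) ^ (β - 1))
      (2 * β * (z ^ 2 + z' ^ 2) ^ (β - 1) * ((w ^ 2 + w' ^ 2)
        + 2 * (β - 1) * ((z * w + z' * w') ^ 2 / (z ^ 2 + z' ^ 2)))) 0 := by
  have hl : ∀ (a b s : ℝ), HasDerivAt (fun s : ℝ => a + s * b) b s := by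
    intro a b s
    simpa using ((hasDerivAt_id s).mul_const b).const_add a
  have hq' : ∀ s, HasDerivAt (fun s : ℝ => (z + s * w) ^ 2 + (z' + s * w') ^ 2)
      (2 * (z + s * w) * w + 2 * (z' + s * w') * w') s := by
    intro s
    simpa using ((hl z w s).fun_pow 2).fun_add ((hl z' w' s).fun_pow 2)
  have hpos : ∀ᶠ s in nhds (0:ℝ), 0 < (z + s * w) ^ 2 + (z' + s * w') ^ 2 := by
    have : ContinuousAt (fun s : ℝ => (z + s * w) ^ 2 + (z' + s * w') ^ 2) 0 := by fun_prop
    exact this.eventually (lt_mem_nhds (by simpa using hq))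
  refine ⟨?_, ?_⟩
  · filter_upwards [hpos] with s hs
    exact (hq' s).rpow_const (Or.inl hs.ne')
  · have h1 : HasDerivAt (fun s : ℝ => (2 * (z + s * w) * w + 2 * (z' + s * w') * w') * β)
        ((2 * w * w + 2 * w' * w') * β) 0 := by
      exact ((((hl z w 0).const_mul 2).mul_const w).fun_add
        (((hl z' w' 0).const_mul 2).mul_const w')).mul_const β
    have h2 := h1.fun_mul ((hq' 0).rpow_const (p := β - 1) (Or.inl (by simpa using hq.ne')))
    refine h2.congr_deriv ?_
    simp only [zero_mul, add_zero]
    have h3 : (z ^ 2 + z' ^ 2) ^ (β - 1 - 1) = (z ^ 2 + z' ^ 2) ^ (β - 1) / (z ^ 2 + z' ^ 2) := by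
      rw [Real.rpow_sub_one hq.ne']
    rw [h3]
    field_simp

lemma sq_line {d : ℕ} (x X : Fin d → ℝ) (s : ℝ) :
    HasDerivAt (fun s : ℝ => ∑ j, (x j + s * X j) ^ 2) (∑ j, 2 * (x j + s * X j) * X j) s := by
  apply HasDerivAt.fun_sum
  intro j _
  have : HasDerivAt (fun s : ℝ => x j + s * X j) (X j) s := by
    simpa using ((hasDerivAt_id s).mul_const (X j)).const_add (x j)
  simpa using this.fun_pow 2

lemma sq_line2 {d : ℕ} (x X : Fin d → ℝ) (s : ℝ) :
    HasDerivAt (fun s : ℝ => ∑ j, 2 * (x j + s * X j) * X j) (∑ j, 2 * X j * X j) s := by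
  apply HasDerivAt.fun_sum
  intro j _
  have : HasDerivAt (fun s : ℝ => x j + s * X j) (X j) s := by
    simpa using ((hasDerivAt_id s).mul_const (X j)).const_add (x j)
  exact (this.const_mul 2).mul_const (X j)

/-- the part of the second derivatives coming from `v` -/
lemma v_part {d : ℕ} {δ : ℝ} (hδ : 0 < δ) {a : ℝ × (Fin d → ℝ) → Fin d → Fin d → ℝ}
    (ha : Elliptic δ a) {v : ℝ × (Fin d → ℝ) → ℝ}
    (p : ℝ × (Fin d → ℝ)) (hL : Lop a v p = 0) (C2 : ℝ) (hC20 : 0 ≤ C2)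
    (hC2 : ∀ j k : Fin d, 2 ≤ (j : ℕ) → 2 ≤ (k : ℕ) → |pd2 j k v p| ≤ C2) {m : ℕ}
    (X : Fin m → Fin d → ℝ) (h1 : ∀ j k : Fin d, (j : ℕ) < 2 → ∑ i, X i j * X i k = a p j k)
    (h2 : ∀ j k : Fin d, 2 ≤ (j : ℕ) → 2 ≤ (k : ℕ) → |∑ i, X i j * X i k| ≤ 8 * δ⁻¹ ^ 3) :
    |(∑ i, ∑ j, ∑ k, X i j * X i k * pd2 j k v p) - pt v p| ≤
      d * (d * ((8 * δ⁻¹ ^ 3 + δ⁻¹) * C2)) := by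
  have hE : EllM δ (a p) := ha p
  have e1 : ∑ i, ∑ j, ∑ k, X i j * X i k * pd2 j k v p
      = ∑ j, ∑ k, (∑ i, X i j * X i k) * pd2 j k v p := by
    simp only [Finset.sum_mul]
    rw [Finset.sum_comm]
    refine Finset.sum_congr rfl fun j _ => ?_
    rw [Finset.sum_comm]
  have e2 : pt v p = ∑ j, ∑ k, a p j k * pd2 j k v p := by
    rw [Lop] at hL; linarith
  rw [e1, e2, ← Finset.sum_sub_distrib]
  have hC0 : ∀ j k : Fin d, |(∑ i, X i j * X i k) * pd2 j k v p - a p j k * pd2 j k v p|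
      ≤ (8 * δ⁻¹ ^ 3 + δ⁻¹) * |C2| := by
    intro j k
    have hnn : 0 ≤ (8 * δ⁻¹ ^ 3 + δ⁻¹) * |C2| := by positivity
    by_cases hj : (j : ℕ) < 2
    · rw [h1 j k hj, sub_self, abs_zero]; exact hnn
    by_cases hk : (k : ℕ) < 2
    · have : ∑ i, X i j * X i k = a p j k := by
        rw [hE.1 j k, ← h1 k j hk]
        exact Finset.sum_congr rfl fun i _ => mul_comm _ _
      rw [this, sub_self, abs_zero]; exact hnn
    push Not at hj hk
    rw [← sub_mul, abs_mul]
    have haa : |a p j k| ≤ δ⁻¹ := by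
      by_cases hjk : j = k
      · subst hjk
        rw [abs_le]
        have := ha.diag_le p j
        constructor <;> linarith [inv_pos.2 hδ]
      · exact hE.abs_le hδ hjk
    exact mul_le_mul ((abs_sub _ _).trans (add_le_add (h2 j k hj hk) haa))
      ((hC2 j k hj hk).trans (le_abs_self _)) (abs_nonneg _) (by positivity)
  rw [abs_of_nonneg hC20] at hC0
  refine (Finset.abs_sum_le_sum_abs _ _).trans ?_
  have : ∀ j ∈ Finset.univ, |∑ k, (∑ i, X i j * X i k) * pd2 j k v p - ∑ k, a p j k * pd2 j k v p|
      ≤ d * ((8 * δ⁻¹ ^ 3 + δ⁻¹) * C2) := by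
    intro j _
    rw [← Finset.sum_sub_distrib]
    refine (Finset.abs_sum_le_sum_abs _ _).trans ?_
    refine (Finset.sum_le_sum fun k _ => hC0 j k).trans ?_
    simp
  refine (Finset.sum_le_sum this).trans ?_
  simp

/-! ### Coupling: the Hölder estimate in `x'` -/

lemma psi_sum {n : ℕ} {δ β : ℝ} (hδ : 0 < δ) (hβ : β = δ ^ 2 / 16) (z z' : ℝ)
    (hq : 0 < z ^ 2 + z' ^ 2) (hq1 : z ^ 2 + z' ^ 2 ≤ 1) (hβ1 : β ≤ 1) (w w' : Fin n → ℝ)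
    (h1 : 2 * δ ≤ ∑ i, (z / √(z ^ 2 + z' ^ 2) * w i + z' / √(z ^ 2 + z' ^ 2) * w' i) ^ 2
      - ∑ i, (-(z' / √(z ^ 2 + z' ^ 2)) * w i + z / √(z ^ 2 + z' ^ 2) * w' i) ^ 2)
    (h2 : ∑ i, (w i ^ 2 + w' i ^ 2) ≤ 8 * δ⁻¹) :
    ∑ i, (2 * β * (z ^ 2 + z' ^ 2) ^ (β - 1) * ((w i ^ 2 + w' i ^ 2)
        + 2 * (β - 1) * ((z * w i + z' * w' i) ^ 2 / (z ^ 2 + z' ^ 2)))) ≤ -(2 * β * δ) := by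
  have hr : √(z ^ 2 + z' ^ 2) ^ 2 = z ^ 2 + z' ^ 2 := Real.sq_sqrt hq.le
  have hr0 : 0 < √(z ^ 2 + z' ^ 2) := Real.sqrt_pos.2 hq
  set r := √(z ^ 2 + z' ^ 2) with hrdef
  set e := z / r with he
  set e' := z' / r with he'
  have hee : e ^ 2 + e' ^ 2 = 1 := by
    rw [he, he', div_pow, div_pow, ← add_div, hr]; exact div_self hq.ne'
  have hz : z = r * e := by rw [he]; field_simp
  have hz' : z' = r * e' := by rw [he']; field_simp
  have hβ0 : 0 ≤ β := by rw [hβ]; positivity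
  have t1 : ∀ i, 2 * β * (z ^ 2 + z' ^ 2) ^ (β - 1) * ((w i ^ 2 + w' i ^ 2)
        + 2 * (β - 1) * ((z * w i + z' * w' i) ^ 2 / (z ^ 2 + z' ^ 2)))
      = 2 * β * (z ^ 2 + z' ^ 2) ^ (β - 1) * ((-e' * w i + e * w' i) ^ 2 - (e * w i + e' * w' i) ^ 2
        + 2 * β * (e * w i + e' * w' i) ^ 2) := by
    intro i
    have : (z * w i + z' * w' i) ^ 2 / (z ^ 2 + z' ^ 2) = (e * w i + e' * w' i) ^ 2 := by
      rw [div_eq_iff hq.ne', ← hr]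
      nth_rewrite 1 [hz, hz']
      ring
    rw [this]
    have : w i ^ 2 + w' i ^ 2 = (-e' * w i + e * w' i) ^ 2 + (e * w i + e' * w' i) ^ 2 := by
      linear_combination (-(w i ^ 2 + w' i ^ 2)) * hee
    rw [this]; ring
  rw [Finset.sum_congr rfl fun i _ => t1 i, ← Finset.mul_sum, Finset.sum_add_distrib,
    Finset.sum_sub_distrib, ← Finset.mul_sum]
  have h3 : ∑ i, (e * w i + e' * w' i) ^ 2 ≤ 8 * δ⁻¹ := by
    refine le_trans (Finset.sum_le_sum fun i _ => ?_) h2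
    have : w i ^ 2 + w' i ^ 2 = (-e' * w i + e * w' i) ^ 2 + (e * w i + e' * w' i) ^ 2 := by
      linear_combination (-(w i ^ 2 + w' i ^ 2)) * hee
    rw [this]; linarith [sq_nonneg (-e' * w i + e * w' i)]
  have h4 : 2 * β * ∑ i, (e * w i + e' * w' i) ^ 2 ≤ δ := by
    calc _ ≤ 2 * β * (8 * δ⁻¹) := by gcongr
      _ = δ := by rw [hβ]; field_simp; norm_num
  have h5 : ∑ i, (-e' * w i + e * w' i) ^ 2 - ∑ i, (e * w i + e' * w' i) ^ 2
      + 2 * β * ∑ i, (e * w i + e' * w' i) ^ 2 ≤ -δ := by linarith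
  have hQ : 1 ≤ (z ^ 2 + z' ^ 2) ^ (β - 1) :=
    Real.one_le_rpow_of_pos_of_le_one_of_nonpos hq hq1 (by linarith)
  have h6 : 0 ≤ 2 * β * (z ^ 2 + z' ^ 2) ^ (β - 1) := by positivity
  refine (mul_le_mul_of_nonneg_left h5 h6).trans ?_
  nlinarith [mul_nonneg hβ0 hδ.le]

def coupF {d : ℕ} (i0 i1 : Fin d) (v : ℝ × (Fin d → ℝ) → ℝ) (A β t0 : ℝ)
    (P : ℝ × ((Fin d → ℝ) × (Fin d → ℝ))) : ℝ :=
  v (P.1, P.2.1) - v (P.1, P.2.2) - A * ((P.2.1 i0 - P.2.2 i0) ^ 2 + (P.2.1 i1 - P.2.2 i1) ^ 2) ^ β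
    - 32 * (∑ j, P.2.1 j ^ 2 + ∑ j, P.2.2 j ^ 2 + (t0 - P.1))

def coupK (d : ℕ) (t0 : ℝ) : Set (ℝ × ((Fin d → ℝ) × (Fin d → ℝ))) :=
  {P | P.1 ≤ t0 ∧ (∀ k : Fin d, 2 ≤ (k : ℕ) → P.2.1 k = P.2.2 k) ∧
    ∑ j, P.2.1 j ^ 2 + ∑ j, P.2.2 j ^ 2 + (t0 - P.1) ≤ 1 / 16}

lemma coupK_compact (d : ℕ) (t0 : ℝ) : IsCompact (coupK d t0) := by
  refine IsCompact.of_isClosed_subset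
    (isCompact_Icc (a := (t0 - 1, ((fun _ => -1 : Fin d → ℝ), (fun _ => -1 : Fin d → ℝ))))
      (b := (t0, ((fun _ => 1 : Fin d → ℝ), (fun _ => 1 : Fin d → ℝ))))) ?_ ?_
  · have h1 : IsClosed {P : ℝ × ((Fin d → ℝ) × (Fin d → ℝ)) | P.1 ≤ t0} :=
      isClosed_le continuous_fst continuous_const
    have h2 : IsClosed {P : ℝ × ((Fin d → ℝ) × (Fin d → ℝ)) |
        ∀ k : Fin d, 2 ≤ (k : ℕ) → P.2.1 k = P.2.2 k} := by
      simp only [Set.ofPred_forall]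
      refine isClosed_iInter fun k => isClosed_iInter fun _ => ?_
      exact isClosed_eq (f := fun P : ℝ × ((Fin d → ℝ) × (Fin d → ℝ)) => P.2.1 k)
        (g := fun P => P.2.2 k) (by fun_prop) (by fun_prop)
    have h3 : IsClosed {P : ℝ × ((Fin d → ℝ) × (Fin d → ℝ)) |
        ∑ j, P.2.1 j ^ 2 + ∑ j, P.2.2 j ^ 2 + (t0 - P.1) ≤ 1 / 16} :=
      isClosed_le (f := fun P : ℝ × ((Fin d → ℝ) × (Fin d → ℝ)) =>
        ∑ j, P.2.1 j ^ 2 + ∑ j, P.2.2 j ^ 2 + (t0 - P.1)) (by fun_prop) continuous_const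
    exact h1.inter (h2.inter h3)
  · rintro ⟨t, x, y⟩ ⟨h1, -, h2⟩
    simp only at h1 h2
    have hx : 0 ≤ ∑ j, x j ^ 2 := Finset.sum_nonneg fun i _ => sq_nonneg _
    have hy : 0 ≤ ∑ j, y j ^ 2 := Finset.sum_nonneg fun i _ => sq_nonneg _
    have hxj : ∀ j, |x j| ≤ 1 := fun j => by
      have := Finset.single_le_sum (f := fun j => x j ^ 2) (fun i _ => sq_nonneg _) (Finset.mem_univ j)
      rw [← sq_le_one_iff_abs_le_one]; linarith
    have hyj : ∀ j, |y j| ≤ 1 := fun j => by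
      have := Finset.single_le_sum (f := fun j => y j ^ 2) (fun i _ => sq_nonneg _) (Finset.mem_univ j)
      rw [← sq_le_one_iff_abs_le_one]; linarith
    exact ⟨⟨by simp only; linarith, fun j => (abs_le.1 (hxj j)).1, fun j => (abs_le.1 (hyj j)).1⟩,
      ⟨h1, fun j => (abs_le.1 (hxj j)).2, fun j => (abs_le.1 (hyj j)).2⟩⟩

set_option maxHeartbeats 2000000 in
lemma coup_holder (d : ℕ) (δ : ℝ) (hδ : 0 < δ) (hδ1 : δ ≤ 1) (i0 i1 : Fin d)
    (hi0 : (i0 : ℕ) = 0) (hi1 : (i1 : ℕ) = 1) (C2 : ℝ) (hC2 : 0 ≤ C2) :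
    ∃ A : ℝ, 0 ≤ A ∧ ∀ (a : ℝ × (Fin d → ℝ) → Fin d → Fin d → ℝ), Elliptic δ a →
      (∀ t x y, a (t, x) i0 i0 + a (t, x) i1 i1 = a (t, y) i0 i0 + a (t, y) i1 i1) →
      ∀ v : ℝ × (Fin d → ℝ) → ℝ, Sm v → (∀ p ∈ Om d (1 / 4), Lop a v p = 0) →
      (∀ p ∈ Om d (1 / 4), |v p| ≤ 1) →
      (∀ p ∈ Om d (1 / 4), ∀ j k : Fin d, 2 ≤ (j : ℕ) → 2 ≤ (k : ℕ) → |pd2 j k v p| ≤ C2) →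
      ∀ t0 : ℝ, -(1 / 16) < t0 → t0 < 0 → ∀ x y : Fin d → ℝ,
      (∀ k : Fin d, 2 ≤ (k : ℕ) → x k = y k) → ∑ j, x j ^ 2 + ∑ j, y j ^ 2 ≤ 1 / 16 →
      v (t0, x) - v (t0, y) ≤ A * ((x i0 - y i0) ^ 2 + (x i1 - y i1) ^ 2) ^ (δ ^ 2 / 16)
        + 32 * (∑ j, x j ^ 2 + ∑ j, y j ^ 2) := by
  set β : ℝ := δ ^ 2 / 16 with hβ
  have hβ0 : 0 < β := by positivity
  have hβ1 : β ≤ 1 := by rw [hβ]; nlinarith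
  have hδi : 0 < δ⁻¹ := inv_pos.2 hδ
  set C5 : ℝ := d * (d * ((8 * δ⁻¹ ^ 3 + δ⁻¹) * C2)) with hC5
  set C6 : ℝ := d * (8 * δ⁻¹ ^ 3 + δ⁻¹) with hC6
  have hC50 : 0 ≤ C5 := by positivity
  have hC60 : 0 ≤ C6 := by positivity
  set A : ℝ := (33 + 2 * C5 + 128 * C6) / (2 * β * δ) with hAdef
  have hA : A * (2 * β * δ) = 33 + 2 * C5 + 128 * C6 := by rw [hAdef]; field_simp
  have hA0 : 0 ≤ A := by positivity
  have hi01 : i0 ≠ i1 := by intro h; rw [h] at hi0; omega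
  refine ⟨A, hA0, ?_⟩
  intro a ha htr v hv hL hv1 hD2 t0 ht0 ht0' x0 y0 hxy0 hsum0
  have hFc : Continuous (coupF i0 i1 v A β t0) := by
    have := hv.continuous
    unfold coupF
    have hr : Continuous fun P : ℝ × ((Fin d → ℝ) × (Fin d → ℝ)) =>
        ((P.2.1 i0 - P.2.2 i0) ^ 2 + (P.2.1 i1 - P.2.2 i1) ^ 2) ^ β :=
      Continuous.rpow_const (by fun_prop) (fun _ => Or.inr hβ0.le)
    fun_prop
  have hmem0 : (t0, (x0, y0)) ∈ coupK d t0 := ⟨le_rfl, hxy0, by simpa using hsum0⟩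
  obtain ⟨⟨t, x, y⟩, hP, hPm⟩ := (coupK_compact d t0).exists_isMaxOn ⟨_, hmem0⟩ hFc.continuousOn
  suffices hmain : coupF i0 i1 v A β t0 (t, (x, y)) ≤ 0 by
    have h := (hPm hmem0 : coupF i0 i1 v A β t0 (t0, (x0, y0)) ≤ coupF i0 i1 v A β t0 (t, (x, y)))
    have h' := h.trans hmain
    simp only [coupF, sub_self, add_zero] at h'
    linarith
  by_contra hpos
  push Not at hpos
  obtain ⟨htt, hxy, hg⟩ := hP
  simp only at htt hxy hg
  have hx2 : 0 ≤ ∑ j, x j ^ 2 := Finset.sum_nonneg fun i _ => sq_nonneg _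
  have hy2 : 0 ≤ ∑ j, y j ^ 2 := Finset.sum_nonneg fun i _ => sq_nonneg _
  have hxO : (t, x) ∈ Om d (1 / 4) := ⟨lt_of_le_of_lt htt ht0', by simp only; linarith⟩
  have hyO : (t, y) ∈ Om d (1 / 4) := ⟨lt_of_le_of_lt htt ht0', by simp only; linarith⟩
  set q0 := (x i0 - y i0) ^ 2 + (x i1 - y i1) ^ 2 with hq0
  have hq00 : 0 ≤ q0 := by positivity
  have hrp : 0 ≤ A * q0 ^ β := by positivity
  have hF : 0 < v (t, x) - v (t, y) - A * q0 ^ β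
      - 32 * (∑ j, x j ^ 2 + ∑ j, y j ^ 2 + (t0 - t)) := hpos
  have hq : 0 < q0 := by
    rcases hq00.lt_or_eq with h | h
    · exact h
    exfalso
    have e1 : x i0 = y i0 := by nlinarith [sq_nonneg (x i0 - y i0), sq_nonneg (x i1 - y i1)]
    have e2 : x i1 = y i1 := by nlinarith [sq_nonneg (x i0 - y i0), sq_nonneg (x i1 - y i1)]
    have : x = y := by
      ext k
      by_cases hk : 2 ≤ (k : ℕ)
      · exact hxy k hk
      · have : (k : ℕ) = 0 ∨ (k : ℕ) = 1 := by omega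
        rcases this with h | h
        · have : k = i0 := by ext; omega
          rw [this, e1]
        · have : k = i1 := by ext; omega
          rw [this, e2]
    rw [this] at hF
    linarith
  have hg' : ∑ j, x j ^ 2 + ∑ j, y j ^ 2 + (t0 - t) < 1 / 16 := by
    have h1 := (abs_le.1 (hv1 _ hxO)).2
    have h2 := (abs_le.1 (hv1 _ hyO)).1
    linarith
  have two_le : ∀ u : Fin d → ℝ, u i0 ^ 2 + u i1 ^ 2 ≤ ∑ j, u j ^ 2 := by
    intro u
    rw [← Finset.sum_pair (f := fun j => u j ^ 2) hi01]
    exact Finset.sum_le_sum_of_subset_of_nonneg (Finset.subset_univ _) fun i _ _ => sq_nonneg _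
  have hq1 : q0 ≤ 1 := by
    have h1 := two_le x
    have h2 := two_le y
    nlinarith [sq_nonneg (x i0 + y i0), sq_nonneg (x i1 + y i1)]
  -- nearby points
  have hnear : ∀ᶠ P in nhds (t, (x, y)), P.1 ≤ t0 → (∀ k : Fin d, 2 ≤ (k : ℕ) → P.2.1 k = P.2.2 k) →
      coupF i0 i1 v A β t0 P ≤ coupF i0 i1 v A β t0 (t, (x, y)) := by
    have hc : Continuous (fun P : ℝ × ((Fin d → ℝ) × (Fin d → ℝ)) =>
        ∑ j, P.2.1 j ^ 2 + ∑ j, P.2.2 j ^ 2 + (t0 - P.1)) := by fun_prop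
    filter_upwards [hc.continuousAt.eventually (gt_mem_nhds hg')] with P h1 h2 h3
    exact hPm ⟨h2, h3, h1.le⟩
  -- time
  have htime : 0 ≤ pt v (t, x) - pt v (t, y) + 32 := by
    have hd1 : HasDerivAt (fun s : ℝ => coupF i0 i1 v A β t0 (s, (x, y)))
        (pt v (t, x) - pt v (t, y) + 32) t := by
      have h1 := (((tline hv t x).fun_sub (tline hv t y)).sub_const (A * q0 ^ β)).fun_sub
        ((((hasDerivAt_id t).const_sub t0).const_add (∑ j, x j ^ 2 + ∑ j, y j ^ 2)).const_mul 32)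
      refine h1.congr_deriv ?_
      ring
    refine first_test hd1 ?_
    have hl : Tendsto (fun s : ℝ => (s, (x, y))) (nhdsWithin t (Iio t)) (nhds (t, (x, y))) :=
      (Continuous.tendsto' (by fun_prop) _ _ rfl).mono_left nhdsWithin_le_nhds
    filter_upwards [hl.eventually hnear, self_mem_nhdsWithin] with s hs hst
    exact hs ((le_of_lt hst).trans htt) hxy
  -- space
  have hee : ((x i0 - y i0) / √q0) ^ 2 + ((x i1 - y i1) / √q0) ^ 2 = 1 := by
    rw [div_pow, div_pow, ← add_div, Real.sq_sqrt hq00]; exact div_self hq.ne'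
  obtain ⟨X, Y, c1, c2, c3, c4, c5⟩ := coupling hδ (a (t, x)) (a (t, y)) (ha _) (ha _) i0 i1 hi0 hi1
    (htr t x y) _ _ hee
  have c4' : ∀ j k : Fin d, 2 ≤ (j : ℕ) → 2 ≤ (k : ℕ) → |∑ i, Y i j * Y i k| ≤ 8 * δ⁻¹ ^ 3 := by
    intro j k hj hk
    have := c4 j k hj hk
    simp only [c1 _ j hj, c1 _ k hk] at this
    exact this
  have hvx := v_part hδ ha (t, x) (hL _ hxO) C2 hC2 (hD2 _ hxO) X c2 c4
  have hvy := v_part hδ ha (t, y) (hL _ hyO) C2 hC2 (hD2 _ hyO) Y c3 c4'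
  have diagX : ∑ i, ∑ j, 2 * X i j * X i j ≤ 2 * C6 := by
    rw [Finset.sum_comm]
    have : ∀ j ∈ Finset.univ, ∑ i, 2 * X i j * X i j ≤ 2 * (8 * δ⁻¹ ^ 3 + δ⁻¹) := by
      intro j _
      have e : ∑ i, 2 * X i j * X i j = 2 * ∑ i, X i j * X i j := by
        rw [Finset.mul_sum]; exact Finset.sum_congr rfl fun i _ => by ring
      rw [e]
      have h3 : 0 ≤ 8 * δ⁻¹ ^ 3 := by positivity
      by_cases hj : (j : ℕ) < 2
      · rw [c2 j j hj]
        have := (ha.diag_le (t, x) j).2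
        linarith
      · have := (abs_le.1 (c4 j j (by omega) (by omega))).2
        linarith
    refine (Finset.sum_le_sum this).trans ?_
    simp only [Finset.sum_const, Finset.card_univ, Fintype.card_fin, nsmul_eq_mul, hC6]
    linarith
  have diagY : ∑ i, ∑ j, 2 * Y i j * Y i j ≤ 2 * C6 := by
    rw [Finset.sum_comm]
    have : ∀ j ∈ Finset.univ, ∑ i, 2 * Y i j * Y i j ≤ 2 * (8 * δ⁻¹ ^ 3 + δ⁻¹) := by
      intro j _
      have e : ∑ i, 2 * Y i j * Y i j = 2 * ∑ i, Y i j * Y i j := by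
        rw [Finset.mul_sum]; exact Finset.sum_congr rfl fun i _ => by ring
      rw [e]
      have h3 : 0 ≤ 8 * δ⁻¹ ^ 3 := by positivity
      by_cases hj : (j : ℕ) < 2
      · rw [c3 j j hj]
        have := (ha.diag_le (t, y) j).2
        linarith
      · have := (abs_le.1 (c4' j j (by omega) (by omega))).2
        linarith
    refine (Finset.sum_le_sum this).trans ?_
    simp only [Finset.sum_const, Finset.card_univ, Fintype.card_fin, nsmul_eq_mul, hC6]
    linarith
  have hw : ∑ i, ((X i i0 - Y i i0) ^ 2 + (X i i1 - Y i i1) ^ 2) ≤ 8 * δ⁻¹ := by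
    have hb : ∑ i, ((X i i0 - Y i i0) ^ 2 + (X i i1 - Y i i1) ^ 2) ≤
        ∑ i, (2 * (X i i0 * X i i0) + 2 * (Y i i0 * Y i i0) + 2 * (X i i1 * X i i1) + 2 * (Y i i1 * Y i i1)) := by
      refine Finset.sum_le_sum fun i _ => ?_
      nlinarith [sq_nonneg (X i i0 + Y i i0), sq_nonneg (X i i1 + Y i i1)]
    refine hb.trans ?_
    simp only [Finset.sum_add_distrib, ← Finset.mul_sum]
    rw [c2 i0 i0 (by omega), c2 i1 i1 (by omega), c3 i0 i0 (by omega), c3 i1 i1 (by omega)]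
    have h1 := (ha.diag_le (t, x) i0).2
    have h2 := (ha.diag_le (t, x) i1).2
    have h3 := (ha.diag_le (t, y) i0).2
    have h4 := (ha.diag_le (t, y) i1).2
    linarith
  have hpsi := psi_sum hδ hβ (x i0 - y i0) (x i1 - y i1) hq hq1 hβ1
    (fun i => X i i0 - Y i i0) (fun i => X i i1 - Y i i1) c5 hw
  have hsec : ∀ i, (∑ j, ∑ k, X i j * X i k * pd2 j k v (t, x))
      - (∑ j, ∑ k, Y i j * Y i k * pd2 j k v (t, y))
      - A * (2 * β * q0 ^ (β - 1) * (((X i i0 - Y i i0) ^ 2 + (X i i1 - Y i i1) ^ 2)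
        + 2 * (β - 1) * (((x i0 - y i0) * (X i i0 - Y i i0)
          + (x i1 - y i1) * (X i i1 - Y i i1)) ^ 2 / q0)))
      - 32 * (∑ j, 2 * X i j * X i j + ∑ j, 2 * Y i j * Y i j) ≤ 0 := by
    intro i
    obtain ⟨r1, r2⟩ := rpow_line (x i0 - y i0) (x i1 - y i1) (X i i0 - Y i i0) (X i i1 - Y i i1) β hq
    have sx := sline2 hv t x (X i) 0
    have sy := sline2 hv t y (Y i) 0
    have d2 := (((sx.fun_sub sy).fun_sub (r2.const_mul A)).fun_sub
      (((sq_line2 x (X i) 0).fun_add (sq_line2 y (Y i) 0)).const_mul 32))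
    simp only [zero_smul, add_zero] at d2
    refine second_test' (g := fun s => v (t, x + s • X i) - v (t, y + s • Y i)
      - A * (((x i0 - y i0) + s * (X i i0 - Y i i0)) ^ 2 + ((x i1 - y i1) + s * (X i i1 - Y i i1)) ^ 2) ^ β
      - 32 * ((∑ j, (x j + s * X i j) ^ 2 + ∑ j, (y j + s * Y i j) ^ 2) + (t0 - t))) ?_ d2 ?_
    · filter_upwards [r1] with s hs
      exact (((sline hv t x (X i) s).fun_sub (sline hv t y (Y i) s)).fun_sub (hs.const_mul A)).fun_sub
        ((((sq_line x (X i) s).fun_add (sq_line y (Y i) s)).add_const (t0 - t)).const_mul 32)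
    · have hl : Tendsto (fun s : ℝ => (t, (x + s • X i, y + s • Y i))) (nhds 0) (nhds (t, (x, y))) :=
        (Continuous.tendsto' (by fun_prop) _ _ (by simp))
      filter_upwards [hl.eventually hnear] with s hs
      have := hs htt (fun k hk => by simp [hxy k hk, c1 i k hk])
      simp only [coupF, Pi.add_apply, Pi.smul_apply, smul_eq_mul] at this
      have e1 : x i0 + s * X i i0 - (y i0 + s * Y i i0) = (x i0 - y i0) + s * (X i i0 - Y i i0) := by ring
      have e2 : x i1 + s * X i i1 - (y i1 + s * Y i i1) = (x i1 - y i1) + s * (X i i1 - Y i i1) := by ring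
      rw [e1, e2] at this
      simpa using this
  have hsum := Finset.sum_nonpos (s := Finset.univ) fun i _ => hsec i
  simp only [Finset.sum_sub_distrib, ← Finset.mul_sum, Finset.sum_add_distrib] at hsum
  simp only [← Finset.mul_sum, Finset.sum_add_distrib] at hpsi
  have hpA := mul_le_mul_of_nonneg_left hpsi hA0
  have f1 := (abs_le.1 hvx).1
  have f2 := (abs_le.1 hvy).2
  rw [← hC5] at f1 f2
  have f3 : A * -(2 * β * δ) = -(33 + 2 * C5 + 128 * C6) := by rw [← hA]; ring
  rw [f3] at hpA
  linarith

/-! ### Unit scale oscillation estimate -/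

def Good {d : ℕ} (δ : ℝ) (i0 i1 : Fin d) (a : ℝ × (Fin d → ℝ) → Fin d → Fin d → ℝ) : Prop :=
  Elliptic δ a ∧ Ind a ∧
    ∀ t x y, a (t, x) i0 i0 + a (t, x) i1 i1 = a (t, y) i0 i0 + a (t, y) i1 i1

lemma sqrt_le_rpow {S β : ℝ} (h0 : 0 ≤ S) (h1 : S ≤ 1) (hβ0 : 0 ≤ β) (hβ : β ≤ 1 / 2) :
    √S ≤ S ^ β := by
  rw [Real.sqrt_eq_rpow]
  exact Real.rpow_le_rpow_of_exponent_ge' h0 h1 hβ0 hβ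

lemma space_holder (d : ℕ) (δ : ℝ) (hδ : 0 < δ) (hδ1 : δ ≤ 1) (i0 i1 : Fin d)
    (hi0 : (i0 : ℕ) = 0) (hi1 : (i1 : ℕ) = 1) :
    ∃ C : ℝ, 0 ≤ C ∧ ∀ (a : ℝ × (Fin d → ℝ) → Fin d → Fin d → ℝ), Good δ i0 i1 a →
      ∀ v : ℝ × (Fin d → ℝ) → ℝ, Sm v → (∀ p ∈ Om d 1, Lop a v p = 0) →
      (∀ p ∈ Om d 1, |v p| ≤ 1) →
      ∀ t : ℝ, -(1 / 16) < t → t < 0 → ∀ x : Fin d → ℝ, ∑ j, x j ^ 2 ≤ 1 / 16 →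
      |v (t, x) - v (t, 0)| ≤ C * (∑ j, x j ^ 2) ^ (δ ^ 2 / 16) := by
  obtain ⟨C1, hC1, hb1⟩ := bern_est d δ hδ 1 one_pos le_rfl
  obtain ⟨C2, hC2, hb2⟩ := bern_est d δ hδ (1 / 2) (by norm_num) (by norm_num)
  obtain ⟨A, hA, hco⟩ := coup_holder d δ hδ hδ1 i0 i1 hi0 hi1 (C2 * (C1 * 1)) (by positivity)
  refine ⟨d * C1 + (A + 32), by positivity, ?_⟩
  intro a ⟨ha, hi, htr⟩ v hv hL hv1 t ht ht' x hx
  set β : ℝ := δ ^ 2 / 16 with hβ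
  have hβ0 : 0 < β := by positivity
  have hβ2 : β ≤ 1 / 2 := by rw [hβ]; nlinarith
  have hD1 := hb1 a ha hi v 1 hv hL hv1
  have hsub : Om d (1 / 4) ⊆ Om d 1 := Om_mono (by norm_num)
  have hD2 : ∀ p ∈ Om d (1 / 4), ∀ j k : Fin d, 2 ≤ (j : ℕ) → 2 ≤ (k : ℕ) →
      |pd2 j k v p| ≤ C2 * (C1 * 1) := by
    intro p hp j k hj hk
    refine hb2 a ha hi (pd k v) (C1 * 1) (hv.pd k) ?_ (hD1 k hk) j hj p ?_
    · intro q hq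
      exact diff_eq hi hv (Om_open d 1) hL k hk q (Om_mono (by norm_num) hq)
    · exact Om_mono (by norm_num) hp
  have hco' := hco a ha htr v hv (fun p hp => hL p (hsub hp)) (fun p hp => hv1 p (hsub hp)) hD2 t ht ht'
  set S := ∑ j, x j ^ 2 with hS
  have hS0 : 0 ≤ S := Finset.sum_nonneg fun i _ => sq_nonneg _
  have hS1 : S ≤ 1 := by linarith
  have hSβ : 0 ≤ S ^ β := by positivity
  have hSle : S ≤ S ^ β := by
    have := Real.rpow_le_rpow_of_exponent_ge' hS0 hS1 hβ0.le (by linarith : β ≤ 1)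
    simpa using this
  set xb : Fin d → ℝ := patch x 0 with hxb
  have hxbS : ∑ j, xb j ^ 2 ≤ S := by
    refine Finset.sum_le_sum fun j _ => ?_
    simp only [hxb, patch]
    split_ifs
    · exact le_rfl
    · simp [sq_nonneg]
  have hi01 : i0 ≠ i1 := by intro h; rw [h] at hi0; omega
  have hq : (x i0) ^ 2 + (x i1) ^ 2 ≤ S := by
    rw [hS, ← Finset.sum_pair (f := fun j => x j ^ 2) hi01]
    exact Finset.sum_le_sum_of_subset_of_nonneg (Finset.subset_univ _) fun i _ _ => sq_nonneg _
  have e0 : xb i0 = x i0 := by simp [hxb, patch, hi0]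
  have e1 : xb i1 = x i1 := by simp [hxb, patch, hi1]
  have hqβ : (x i0 ^ 2 + x i1 ^ 2) ^ β ≤ S ^ β := Real.rpow_le_rpow (by positivity) hq hβ0.le
  have hAq := mul_le_mul_of_nonneg_left hqβ hA
  have z2 : ∀ k : Fin d, 2 ≤ (k : ℕ) → xb k = (0 : Fin d → ℝ) k := by
    intro k hk
    have : ¬ ((k : ℕ) < 2) := by omega
    simp [hxb, patch, this]
  have k1 : |v (t, xb) - v (t, 0)| ≤ (A + 32) * S ^ β := by
    rw [abs_le]
    have u1 := hco' xb 0 z2 (by simp; linarith)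
    have u2 := hco' 0 xb (fun k hk => (z2 k hk).symm) (by simp; linarith)
    simp only [e0, e1, Pi.zero_apply, sub_zero, zero_sub, neg_sq, ne_eq, OfNat.ofNat_ne_zero,
      not_false_eq_true, zero_pow, Finset.sum_const_zero, add_zero, zero_add] at u1 u2
    constructor <;> nlinarith
  have hxj : ∀ j, |x j| ≤ S ^ β := by
    intro j
    refine le_trans ?_ (sqrt_le_rpow hS0 hS1 hβ0.le hβ2)
    refine Real.abs_le_sqrt ?_
    exact Finset.single_le_sum (f := fun j => x j ^ 2) (fun i _ => sq_nonneg _) (Finset.mem_univ j)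
  have k2 : |v (t, x) - v (t, xb)| ≤ d * C1 * S ^ β := by
    have hmv := Convex.norm_image_sub_le_of_norm_hasDerivWithin_le (𝕜 := ℝ) (s := Icc (0:ℝ) 1)
      (f := fun s : ℝ => v (t, xb + s • (x - xb)))
      (f' := fun s => ∑ j, (x - xb) j * pd j v (t, xb + s • (x - xb))) (C := d * C1 * S ^ β)
      (x := 0) (y := 1)
      (fun s _ => (sline hv t xb (x - xb) s).hasDerivWithinAt) ?_ (convex_Icc 0 1)
      (by simp) (by simp)
    · simpa using hmv
    · intro s hs
      rw [Real.norm_eq_abs]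
      refine (Finset.abs_sum_le_sum_abs _ _).trans ?_
      have hpt : (t, xb + s • (x - xb)) ∈ Om d (1 / 2) := by
        refine ⟨ht', ?_⟩
        have : ∑ j, (xb + s • (x - xb)) j ^ 2 ≤ S := by
          refine Finset.sum_le_sum fun j _ => ?_
          simp only [hxb, patch, Pi.add_apply, Pi.smul_apply, Pi.sub_apply, smul_eq_mul]
          split_ifs
          · simp
          · simp only [Pi.zero_apply, sub_zero, zero_add, mul_pow]
            have : s ^ 2 ≤ 1 := by nlinarith [hs.1, hs.2]
            nlinarith [sq_nonneg (x j)]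
        simp only
        linarith
      have : ∀ j ∈ Finset.univ, |(x - xb) j * pd j v (t, xb + s • (x - xb))| ≤ C1 * S ^ β := by
        intro j _
        by_cases hj : (j : ℕ) < 2
        · have : (x - xb) j = 0 := by simp [hxb, patch, hj]
          rw [this]; simp; positivity
        · have : (x - xb) j = x j := by simp [hxb, patch, hj]
          rw [this, abs_mul, mul_comm C1]
          refine mul_le_mul (hxj j) ?_ (abs_nonneg _) hSβ
          have := hD1 j (by omega) _ hpt
          linarith
      refine (Finset.sum_le_sum this).trans ?_
      simp only [Finset.sum_const, Finset.card_univ, Fintype.card_fin, nsmul_eq_mul]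
      linarith
  calc |v (t, x) - v (t, 0)| ≤ |v (t, x) - v (t, xb)| + |v (t, xb) - v (t, 0)| := abs_sub_le _ _ _
    _ ≤ d * C1 * S ^ β + (A + 32) * S ^ β := add_le_add k2 k1
    _ = _ := by ring

lemma time_one (d : ℕ) (δ : ℝ) (hδ : 0 < δ) (β C : ℝ) (hβ0 : 0 < β) (hβ1 : β ≤ 1) (hC : 0 ≤ C)
    (a : ℝ × (Fin d → ℝ) → Fin d → Fin d → ℝ) (ha : Elliptic δ a)
    (v : ℝ × (Fin d → ℝ) → ℝ) (hv : Sm v) (hL : ∀ p ∈ Om d 1, Lop a v p = 0)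
    (hv1 : ∀ p ∈ Om d 1, |v p| ≤ 1) (t1 t2 : ℝ) (ht1 : -(1 / 16) < t1) (h12 : t1 < t2) (ht2 : t2 < 0)
    (hsp : ∀ x : Fin d → ℝ, ∑ j, x j ^ 2 ≤ 1 / 16 →
      |v (t1, x) - v (t1, 0)| ≤ C * (∑ j, x j ^ 2) ^ β) :
    v (t2, 0) - v (t1, 0) ≤ (C + (C + 32) * (2 * d * δ⁻¹ + 1)) * (t2 - t1) ^ β := by
  set h := t2 - t1 with hh
  have hh0 : 0 < h := by linarith
  have hh1 : h ≤ 1 := by linarith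
  set B := C + 32 with hB
  set Λ : ℝ := 2 * d * δ⁻¹ + 1 with hΛ
  have hΛ0 : 0 < Λ := by positivity
  set H := h ^ (β - 1) with hH
  have hH1 : 1 ≤ H := Real.one_le_rpow_of_pos_of_le_one_of_nonpos hh0 hh1 (by linarith)
  have hHh : H * h = h ^ β := by
    rw [hH, Real.rpow_sub_one hh0.ne']; field_simp
  set c0 := -v (t1, 0) - C * h ^ β + B * H * Λ * t1 with hc0
  set F : ℝ × (Fin d → ℝ) → ℝ := fun p => v p + qpol d c0 (-(B * H * Λ)) (-(B * H)) p with hF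
  have hFS : Sm F := hv.add (qpol_sm _ _ _ _)
  set K : Set (ℝ × (Fin d → ℝ)) := {p | t1 ≤ p.1 ∧ p.1 ≤ t2 ∧ ∑ j, p.2 j ^ 2 ≤ 1 / 16} with hK
  have hsumc : Continuous (fun p : ℝ × (Fin d → ℝ) => ∑ j, p.2 j ^ 2) := by fun_prop
  have hKc : IsCompact K := by
    refine IsCompact.of_isClosed_subset
      (isCompact_Icc (a := ((-1 : ℝ), (fun _ => -1 : Fin d → ℝ))) (b := ((1:ℝ), (fun _ => 1 : Fin d → ℝ)))) ?_ ?_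
    · exact (isClosed_le continuous_const continuous_fst).inter
        ((isClosed_le continuous_fst continuous_const).inter (isClosed_le hsumc continuous_const))
    · rintro q ⟨h1, h2, h3⟩
      have hsum : ∀ j, |q.2 j| ≤ 1 := fun j => by
        have := Finset.single_le_sum (f := fun j => q.2 j ^ 2) (fun i _ => sq_nonneg _) (Finset.mem_univ j)
        rw [← sq_le_one_iff_abs_le_one]; linarith
      exact ⟨⟨by simp only; linarith, fun j => (abs_le.1 (hsum j)).1⟩,
        ⟨by simp only; linarith, fun j => (abs_le.1 (hsum j)).2⟩⟩
  have hKO : K ⊆ Om d 1 := by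
    rintro q ⟨h1, h2, h3⟩
    exact ⟨by linarith, by linarith⟩
  have h0O : (t1, (0 : Fin d → ℝ)) ∈ Om d 1 := ⟨by simp only; linarith, by simp; linarith⟩
  have hhβ : 0 ≤ h ^ β := by positivity
  have key := max_principle hδ ha hFS K hKc 0 (by
    intro q hq hFq
    have hqO := hKO hq
    obtain ⟨q1, q2, q3⟩ := hq
    set S := ∑ j, q.2 j ^ 2 with hS
    have hS0 : 0 ≤ S := Finset.sum_nonneg fun i _ => sq_nonneg _
    have hFq' : 0 < v q - v (t1, 0) - C * h ^ β - B * H * (S + Λ * (q.1 - t1)) := by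
      have : F q = v q - v (t1, 0) - C * h ^ β - B * H * (S + Λ * (q.1 - t1)) := by
        simp only [hF, qpol, hc0, hS]; ring
      rwa [← this]
    have hB32 : 32 ≤ B := by linarith
    have hBH : 32 ≤ B * H := by nlinarith
    have hΛt : 0 ≤ Λ * (q.1 - t1) := mul_nonneg hΛ0.le (by linarith)
    have hCh : 0 ≤ C * h ^ β := by positivity
    have hSlt : S < 1 / 16 := by
      have h1 := (abs_le.1 (hv1 _ hqO)).2
      have h2 := (abs_le.1 (hv1 _ h0O)).1
      by_contra hc
      push Not at hc
      nlinarith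
    have htlt : t1 < q.1 := by
      rcases q1.lt_or_eq with h1 | h1
      · exact h1
      exfalso
      have h2 := (abs_le.1 (hsp q.2 q3)).2
      have h3 : v (t1, q.2) = v q := by rw [h1]
      rw [h3, ← hS] at h2
      have h4 : C * S ^ β ≤ C * h ^ β + B * H * S := by
        rcases le_total S h with h5 | h5
        · have := Real.rpow_le_rpow hS0 h5 hβ0.le
          have := mul_le_mul_of_nonneg_left this hC
          nlinarith
        · have hSpos : 0 < S := lt_of_lt_of_le hh0 h5
          have h6 : S ^ (β - 1) ≤ H := Real.rpow_le_rpow_of_nonpos hh0 h5 (by linarith)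
          have h7 : S ^ β = S ^ (β - 1) * S := by
            rw [Real.rpow_sub_one hSpos.ne']; field_simp
          rw [h7]
          have h8 : S ^ (β - 1) * S ≤ H * S := mul_le_mul_of_nonneg_right h6 hS0
          have h9 := mul_le_mul_of_nonneg_left h8 hC
          have h10 : 0 ≤ H * S := by positivity
          nlinarith
      have h11 : B * H * (S + Λ * (q.1 - t1)) = B * H * S := by rw [← h1]; ring
      linarith
    refine ⟨?_, ?_⟩
    · filter_upwards [hsumc.continuousAt.eventually (gt_mem_nhds hSlt),
        continuous_fst.continuousAt.eventually (lt_mem_nhds htlt)] with q' h1 h2 h3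
      exact ⟨h2.le, h3.trans q2, h1.le⟩
    · rw [hF, Lop_add a hv (qpol_sm _ _ _ _), hL q hqO, qpol_Lop]
      have h1 := ha.tr_le q
      have h2 : 0 < Λ - 2 * ∑ j, a q j j := by rw [hΛ]; linarith
      have h3 : 0 < B * H := by linarith
      have := mul_pos h3 h2
      linarith)
  have h1 := key (t2, 0) ⟨h12.le, le_rfl, by simp⟩
  simp only [hF, qpol, hc0, Pi.zero_apply, ne_eq, OfNat.ofNat_ne_zero, not_false_eq_true, zero_pow,
    Finset.sum_const_zero, mul_zero, add_zero] at h1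
  have h2 : B * H * Λ * t2 - B * H * Λ * t1 = B * Λ * h ^ β := by rw [← hHh, hh]; ring
  linarith

lemma unit_osc (d : ℕ) (δ : ℝ) (hδ : 0 < δ) (hδ1 : δ ≤ 1) (i0 i1 : Fin d)
    (hi0 : (i0 : ℕ) = 0) (hi1 : (i1 : ℕ) = 1) :
    ∃ C : ℝ, 0 ≤ C ∧ ∀ (a : ℝ × (Fin d → ℝ) → Fin d → Fin d → ℝ), Good δ i0 i1 a →
      ∀ v : ℝ × (Fin d → ℝ) → ℝ, Sm v → (∀ p ∈ Om d 1, Lop a v p = 0) →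
      (∀ p ∈ Om d 1, |v p| ≤ 1) → ∀ r : ℝ, 0 < r → r ≤ 1 / 8 →
      ∀ p ∈ cylQ d 0 0 r, ∀ q ∈ cylQ d 0 0 r, |v p - v q| ≤ C * r ^ (δ ^ 2 / 8) := by
  obtain ⟨C, hC, hsp⟩ := space_holder d δ hδ hδ1 i0 i1 hi0 hi1
  refine ⟨4 * C + (C + (C + 32) * (2 * d * δ⁻¹ + 1)), by positivity, ?_⟩
  intro a hG v hv hL hv1 r hr hr8
  set β : ℝ := δ ^ 2 / 16 with hβ
  have hβ0 : 0 < β := by positivity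
  have hβ1 : β ≤ 1 := by rw [hβ]; nlinarith
  have hrβ : r ^ (δ ^ 2 / 8) = (r ^ 2) ^ β := by
    rw [← Real.rpow_natCast r 2, ← Real.rpow_mul hr.le]; congr 1; rw [hβ]; push_cast; ring
  rw [hrβ]
  have hr2 : r ^ 2 ≤ 1 / 64 := by nlinarith
  set R := (r ^ 2) ^ β with hR
  have hR0 : 0 ≤ R := by positivity
  have hspv := hsp a hG v hv hL hv1
  have hsumsplit : ∀ x : Fin d → ℝ, ∑ j, x j ^ 2 =
      (∑ j : Fin d, if (j : ℕ) < 2 then (x j - (0 : Fin d → ℝ) j) ^ 2 else 0) +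
      (∑ j : Fin d, if (j : ℕ) < 2 then 0 else (x j - (0 : Fin d → ℝ) j) ^ 2) := by
    intro x
    rw [← Finset.sum_add_distrib]
    refine Finset.sum_congr rfl fun j _ => ?_
    split_ifs <;> simp
  have hone : ∀ p ∈ cylQ d 0 0 r, |v p - v (p.1, 0)| ≤ 2 * C * R := by
    rintro ⟨t, x⟩ ⟨⟨h1, h2⟩, h3, h4⟩
    simp only at h1 h2 h3 h4 ⊢
    have hS : ∑ j, x j ^ 2 ≤ 2 * r ^ 2 := by rw [hsumsplit]; linarith
    have := hspv t (by linarith) h2 x (by linarith)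
    refine this.trans ?_
    have hS0 : 0 ≤ ∑ j, x j ^ 2 := Finset.sum_nonneg fun i _ => sq_nonneg _
    have h5 := Real.rpow_le_rpow hS0 hS hβ0.le
    rw [Real.mul_rpow (by norm_num) (by positivity)] at h5
    have h6 : (2:ℝ) ^ β ≤ 2 := by
      have := Real.rpow_le_rpow_of_exponent_le (by norm_num : (1:ℝ) ≤ 2) hβ1
      simpa using this
    have h7 : (2:ℝ) ^ β * (r ^ 2) ^ β ≤ 2 * R := mul_le_mul_of_nonneg_right h6 hR0
    calc _ ≤ C * (2 * R) := mul_le_mul_of_nonneg_left (h5.trans h7) hC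
      _ = _ := by ring
  have hnv : ∀ p ∈ Om d 1, Lop a (fun p => (-1) * v p) p = 0 := by
    intro p hp
    rw [Lop_const_mul a hv _ _ (hG.1 p).1, hL p hp, mul_zero]
  have htime0 : ∀ t1 t2 : ℝ, -(r ^ 2) < t1 → t1 < t2 → t2 < 0 → |v (t2, 0) - v (t1, 0)| ≤
      (C + (C + 32) * (2 * d * δ⁻¹ + 1)) * R := by
    intro t1 t2 h1 h2 h3
    have hle : (t2 - t1) ^ β ≤ R := Real.rpow_le_rpow (by linarith) (by linarith) hβ0.le
    have g1 := time_one d δ hδ β C hβ0 hβ1 hC a hG.1 v hv hL hv1 t1 t2 (by linarith) h2 h3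
      (hspv t1 (by linarith) (by linarith))
    have g2 := time_one d δ hδ β C hβ0 hβ1 hC a hG.1 (fun p => (-1) * v p) (contDiff_const.mul hv) hnv
      (fun p hp => by simpa using hv1 p hp) t1 t2 (by linarith) h2 h3
      (fun x hx => by
        have := hspv t1 (by linarith) (by linarith) x hx
        rw [abs_sub_comm] at this
        refine le_trans (le_of_eq ?_) this
        congr 1; ring)
    have hD : 0 ≤ (C + (C + 32) * (2 * d * δ⁻¹ + 1)) := by positivity
    have := mul_le_mul_of_nonneg_left hle hD
    rw [abs_le]
    constructor <;> linarith
  intro p hp q hq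
  have a1 := hone p hp
  have a2 := hone q hq
  have a3 : |v (p.1, 0) - v (q.1, 0)| ≤ (C + (C + 32) * (2 * d * δ⁻¹ + 1)) * R := by
    have p1 := hp.1.1; have p2 := hp.1.2; have q1 := hq.1.1; have q2 := hq.1.2
    rcases lt_trichotomy p.1 q.1 with h | h | h
    · rw [abs_sub_comm]; exact htime0 _ _ (by linarith) h q2
    · rw [h, sub_self, abs_zero]; positivity
    · exact htime0 _ _ (by linarith) h p2
  rw [abs_le] at a1 a2 a3 ⊢
  constructor <;> linarith [a1.1, a1.2, a2.1, a2.2, a3.1, a3.2]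


/-- parabolic rescaling -/
def resc {d : ℕ} (t0 : ℝ) (x0 : Fin d → ℝ) (R : ℝ) (p : ℝ × (Fin d → ℝ)) : ℝ × (Fin d → ℝ) :=
  (t0 + R ^ 2 * p.1, x0 + R • p.2)

lemma resc_line {d : ℕ} {v : ℝ × (Fin d → ℝ) → ℝ} (hv : Sm v) (t0 : ℝ) (x0 : Fin d → ℝ) (R : ℝ) :
    Sm (fun p => v (resc t0 x0 R p)) := by
  apply hv.comp
  unfold resc
  exact (contDiff_const.add (contDiff_const.mul contDiff_fst)).prodMk
    (contDiff_const.add (contDiff_snd.const_smul R))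

lemma resc_hasFDeriv {d : ℕ} (t0 : ℝ) (x0 : Fin d → ℝ) (R : ℝ) (p w : ℝ × (Fin d → ℝ)) (s : ℝ) :
    resc t0 x0 R (p + s • w) = resc t0 x0 R p + s • (R ^ 2 * w.1, R • w.2) := by
  unfold resc
  ext i
  · simp; ring
  · simp; ring

lemma resc_fderiv {d : ℕ} {v : ℝ × (Fin d → ℝ) → ℝ} (hv : Sm v) (t0 : ℝ) (x0 : Fin d → ℝ) (R : ℝ)
    (p w : ℝ × (Fin d → ℝ)) :
    fderiv ℝ (fun p => v (resc t0 x0 R p)) p w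
      = fderiv ℝ v (resc t0 x0 R p) (R ^ 2 * w.1, R • w.2) := by
  have h1 := line_hasDerivAt (resc_line hv t0 x0 R) p w 0
  have h2 := line_hasDerivAt hv (resc t0 x0 R p) (R ^ 2 * w.1, R • w.2) 0
  simp only [resc_hasFDeriv] at h1
  have := h1.unique h2
  simpa using this

lemma resc_pd {d : ℕ} {v : ℝ × (Fin d → ℝ) → ℝ} (hv : Sm v) (t0 : ℝ) (x0 : Fin d → ℝ) (R : ℝ)
    (j : Fin d) :
    pd j (fun p => v (resc t0 x0 R p)) = fun p => R * pd j v (resc t0 x0 R p) := by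
  ext p
  rw [pd_eq (resc_line hv t0 x0 R), resc_fderiv hv, pd_eq hv]
  have : ((R ^ 2 * (0:ℝ), R • (Pi.single j 1 : Fin d → ℝ)) : ℝ × (Fin d → ℝ))
      = R • ((0 : ℝ), (Pi.single j 1 : Fin d → ℝ)) := by ext <;> simp
  rw [this, map_smul, smul_eq_mul]

lemma resc_pt {d : ℕ} {v : ℝ × (Fin d → ℝ) → ℝ} (hv : Sm v) (t0 : ℝ) (x0 : Fin d → ℝ) (R : ℝ) :
    pt (fun p => v (resc t0 x0 R p)) = fun p => R ^ 2 * pt v (resc t0 x0 R p) := by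
  ext p
  rw [pt_eq (resc_line hv t0 x0 R), resc_fderiv hv, pt_eq hv]
  have : ((R ^ 2 * (1:ℝ), R • (0 : Fin d → ℝ)) : ℝ × (Fin d → ℝ))
      = (R ^ 2) • ((1 : ℝ), (0 : Fin d → ℝ)) := by ext <;> simp
  rw [this, map_smul, smul_eq_mul]

lemma resc_Lop {d : ℕ} {v : ℝ × (Fin d → ℝ) → ℝ} (hv : Sm v) (t0 : ℝ) (x0 : Fin d → ℝ) (R : ℝ)
    (a : ℝ × (Fin d → ℝ) → Fin d → Fin d → ℝ) (p : ℝ × (Fin d → ℝ)) :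
    Lop (fun p => a (resc t0 x0 R p)) (fun p => v (resc t0 x0 R p)) p
      = R ^ 2 * Lop a v (resc t0 x0 R p) := by
  have h2 : ∀ j k, pd2 j k (fun p => v (resc t0 x0 R p))
      = fun p => R ^ 2 * pd2 j k v (resc t0 x0 R p) := by
    intro j k
    unfold pd2
    rw [resc_pd hv, pd_mul (f := fun _ => R) contDiff_const (resc_line (hv.pd k) t0 x0 R), resc_pd (hv.pd k)]
    ext p
    have : pd j (fun _ : ℝ × (Fin d → ℝ) => R) p = 0 := by simp [pd]
    rw [this]; ring
  unfold Lop
  simp only [h2, resc_pt hv]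
  rw [mul_add, Finset.mul_sum]
  congr 1
  · ring
  · refine Finset.sum_congr rfl fun j _ => ?_
    rw [Finset.mul_sum]
    refine Finset.sum_congr rfl fun k _ => by ring

lemma resc_good {d : ℕ} {δ : ℝ} {i0 i1 : Fin d} {a : ℝ × (Fin d → ℝ) → Fin d → Fin d → ℝ}
    (h : Good δ i0 i1 a) (t0 : ℝ) (x0 : Fin d → ℝ) (R : ℝ) :
    Good δ i0 i1 (fun p => a (resc t0 x0 R p)) := by
  refine ⟨fun p => h.1 _, ?_, ?_⟩
  · intro j k t x y hxy
    apply h.2.1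
    intro i hi
    simp [hxy i hi]
  · intro t x y
    exact h.2.2 _ _ _

lemma resc_mem {d : ℕ} (t0 : ℝ) (x0 : Fin d → ℝ) {R : ℝ} (hR : 0 < R) (s : ℝ) (p : ℝ × (Fin d → ℝ)) :
    resc t0 x0 R p ∈ cylQ d t0 x0 (s * R) ↔ p ∈ cylQ d 0 0 s := by
  have e1 : (∑ j : Fin d, if (j : ℕ) < 2 then ((resc t0 x0 R p).2 j - x0 j) ^ 2 else 0)
      = R ^ 2 * ∑ j : Fin d, if (j : ℕ) < 2 then (p.2 j - (0 : Fin d → ℝ) j) ^ 2 else 0 := by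
    rw [Finset.mul_sum]
    refine Finset.sum_congr rfl fun j _ => ?_
    simp only [resc, Pi.add_apply, Pi.smul_apply, smul_eq_mul, Pi.zero_apply]
    split_ifs <;> ring
  have e2 : (∑ j : Fin d, if (j : ℕ) < 2 then 0 else ((resc t0 x0 R p).2 j - x0 j) ^ 2)
      = R ^ 2 * ∑ j : Fin d, if (j : ℕ) < 2 then 0 else (p.2 j - (0 : Fin d → ℝ) j) ^ 2 := by
    rw [Finset.mul_sum]
    refine Finset.sum_congr rfl fun j _ => ?_
    simp only [resc, Pi.add_apply, Pi.smul_apply, smul_eq_mul, Pi.zero_apply]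
    split_ifs <;> ring
  have hR2 : 0 < R ^ 2 := by positivity
  have key : ∀ x y : ℝ, R ^ 2 * x < R ^ 2 * y ↔ x < y := fun x y => mul_lt_mul_iff_right₀ hR2
  unfold cylQ
  simp only [mem_ofPred_eq, e1, e2, mem_Ioo]
  rw [show (s * R) ^ 2 = R ^ 2 * s ^ 2 by ring, key, key]
  have k1 : t0 - R ^ 2 * s ^ 2 < (resc t0 x0 R p).1 ↔ 0 - s ^ 2 < p.1 := by
    rw [← key (0 - s ^ 2)]; simp only [resc]; constructor <;> intro h <;> linarith
  have k2 : (resc t0 x0 R p).1 < t0 ↔ p.1 < 0 := by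
    rw [← key p.1 0]; simp only [resc]; constructor <;> intro h <;> linarith
  rw [k1, k2]

lemma Om_sub_cyl {d : ℕ} {p : ℝ × (Fin d → ℝ)} (h : p ∈ Om d 1) : p ∈ cylQ d 0 0 1 := by
  obtain ⟨h1, h2⟩ := h
  have hs : 0 ≤ ∑ j, p.2 j ^ 2 := Finset.sum_nonneg fun j _ => sq_nonneg _
  refine ⟨⟨by norm_num; linarith, h1⟩, ?_, ?_⟩
  · refine lt_of_le_of_lt (Finset.sum_le_sum (g := fun j => p.2 j ^ 2) fun j _ => ?_) (by linarith)
    split_ifs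
    · simp
    · positivity
  · refine lt_of_le_of_lt (Finset.sum_le_sum (g := fun j => p.2 j ^ 2) fun j _ => ?_) (by linarith)
    split_ifs
    · positivity
    · simp

lemma resc_surj {d : ℕ} (t0 : ℝ) (x0 : Fin d → ℝ) {R : ℝ} (hR : 0 < R) (p : ℝ × (Fin d → ℝ)) :
    ∃ p', resc t0 x0 R p' = p := by
  refine ⟨((p.1 - t0) / R ^ 2, R⁻¹ • (p.2 - x0)), ?_⟩
  unfold resc
  ext i
  · simp; field_simp; ring
  · simp; field_simp; ring

lemma scaled_osc (d : ℕ) (δ : ℝ) (hδ : 0 < δ) (hδ1 : δ ≤ 1) (i0 i1 : Fin d)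
    (hi0 : (i0 : ℕ) = 0) (hi1 : (i1 : ℕ) = 1) :
    ∃ C : ℝ, 0 ≤ C ∧ ∀ (a : ℝ × (Fin d → ℝ) → Fin d → Fin d → ℝ), Good δ i0 i1 a →
      ∀ v : ℝ × (Fin d → ℝ) → ℝ, Sm v → ∀ (t0 : ℝ) (x0 : Fin d → ℝ) (R M : ℝ), 0 < R → 0 < M →
      (∀ p ∈ cylQ d t0 x0 R, Lop a v p = 0) →
      (∀ p ∈ cylQ d t0 x0 R, |v p| ≤ M) → ∀ s : ℝ, 0 < s → s ≤ 1 / 8 →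
      ∀ p ∈ cylQ d t0 x0 (s * R), ∀ q ∈ cylQ d t0 x0 (s * R),
        |v p - v q| ≤ C * M * s ^ (δ ^ 2 / 8) := by
  obtain ⟨C, hC, hu⟩ := unit_osc d δ hδ hδ1 i0 i1 hi0 hi1
  refine ⟨C, hC, ?_⟩
  intro a hG v hv t0 x0 R M hR hM hL hb s hs hs8 p hp q hq
  obtain ⟨p', rfl⟩ := resc_surj t0 x0 hR p
  obtain ⟨q', rfl⟩ := resc_surj t0 x0 hR q
  rw [resc_mem t0 x0 hR] at hp hq
  have hsub : ∀ p ∈ Om d 1, resc t0 x0 R p ∈ cylQ d t0 x0 R := by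
    intro p hp
    have := (resc_mem t0 x0 hR 1 p).2 (Om_sub_cyl hp)
    rwa [one_mul] at this
  have hr := resc_line hv t0 x0 R
  have h := hu _ (resc_good hG t0 x0 R) (fun p => M⁻¹ * v (resc t0 x0 R p))
    (contDiff_const.mul hr)
    (by
      intro p hp
      rw [Lop_const_mul (fun p => a (resc t0 x0 R p)) hr _ _ (fun j k => (hG.1 _).1 j k), resc_Lop hv, hL _ (hsub p hp)]; ring)
    (by
      intro p hp
      have := hb _ (hsub p hp)
      rw [abs_mul, abs_of_pos (inv_pos.2 hM), inv_mul_le_iff₀ hM]; linarith)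
    s hs hs8 p' hp q' hq
  rw [← mul_sub, abs_mul, abs_of_pos (inv_pos.2 hM), inv_mul_le_iff₀ hM] at h
  linarith


lemma cyl_open (d : ℕ) (t : ℝ) (x : Fin d → ℝ) (ρ : ℝ) : IsOpen (cylQ d t x ρ) := by
  have h1 : IsOpen {p : ℝ × (Fin d → ℝ) | p.1 ∈ Set.Ioo (t - ρ ^ 2) t} :=
    isOpen_Ioo.preimage continuous_fst
  have h2 : IsOpen {p : ℝ × (Fin d → ℝ) |
      (∑ j : Fin d, if (j : ℕ) < 2 then (p.2 j - x j) ^ 2 else 0) < ρ ^ 2} := by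
    refine isOpen_lt (continuous_finsetSum _ fun j _ => ?_) continuous_const
    split_ifs <;> fun_prop
  have h3 : IsOpen {p : ℝ × (Fin d → ℝ) |
      (∑ j : Fin d, if (j : ℕ) < 2 then 0 else (p.2 j - x j) ^ 2) < ρ ^ 2} := by
    refine isOpen_lt (continuous_finsetSum _ fun j _ => ?_) continuous_const
    split_ifs <;> fun_prop
  exact h1.inter (h2.inter h3)

lemma sum_tri {d : ℕ} (P : Fin d → Prop) [DecidablePred P] (x y z : Fin d → ℝ) :
    (∑ j : Fin d, if P j then (x j - z j) ^ 2 else 0)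
      ≤ 2 * (∑ j : Fin d, if P j then (x j - y j) ^ 2 else 0)
        + 2 * (∑ j : Fin d, if P j then (y j - z j) ^ 2 else 0) := by
  rw [Finset.mul_sum, Finset.mul_sum, ← Finset.sum_add_distrib]
  refine Finset.sum_le_sum fun j _ => ?_
  split_ifs
  · nlinarith [sq_nonneg (x j - y j - (y j - z j))]
  · simp

lemma ite_flip {d : ℕ} (f : Fin d → ℝ) :
    (∑ j : Fin d, if (j : ℕ) < 2 then 0 else f j) = ∑ j : Fin d, if ¬ ((j : ℕ) < 2) then f j else 0 := by
  refine Finset.sum_congr rfl fun j _ => ?_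
  split_ifs <;> simp

lemma cyl_sub {d : ℕ} {t : ℝ} {x : Fin d → ℝ} {ρ : ℝ} {q : ℝ × (Fin d → ℝ)}
    (hq : q ∈ cylQ d t x (ρ / 2)) : cylQ d q.1 q.2 (ρ / 2) ⊆ cylQ d t x ρ := by
  rintro z ⟨⟨z1, z2⟩, z3, z4⟩
  obtain ⟨⟨q1, q2⟩, q3, q4⟩ := hq
  refine ⟨⟨by nlinarith, by linarith⟩, ?_, ?_⟩
  · have := sum_tri (fun j : Fin d => (j : ℕ) < 2) z.2 q.2 x
    nlinarith
  · rw [ite_flip] at *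
    have := sum_tri (fun j : Fin d => ¬ (j : ℕ) < 2) z.2 q.2 x
    nlinarith

lemma cyl_mono {d : ℕ} {t : ℝ} {x : Fin d → ℝ} {ρ σ : ℝ} (h0 : 0 ≤ ρ) (h : ρ ≤ σ) :
    cylQ d t x ρ ⊆ cylQ d t x σ := by
  rintro z ⟨⟨z1, z2⟩, z3, z4⟩
  have : ρ ^ 2 ≤ σ ^ 2 := by gcongr
  exact ⟨⟨by linarith, z2⟩, by linarith, by linarith⟩

lemma box_real {d : ℕ} (a b : ℝ) (hab : a ≤ b) (x : Fin d → ℝ) (h : ℝ) (hh : 0 ≤ h) :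
    volume.real ((Ioo a b) ×ˢ (pi univ fun j => Ioo (x j - h) (x j + h)) : Set (ℝ × (Fin d → ℝ)))
      = (b - a) * (2 * h) ^ d := by
  rw [Measure.volume_eq_prod, measureReal_prod_prod, Real.volume_real_Ioo_of_le hab]
  congr 1
  rw [Measure.real, Real.volume_pi_Ioo_toReal (fun j => by linarith)]
  rw [Finset.prod_congr rfl (g := fun _ => 2 * h) (fun j _ => by ring)]
  simp

lemma box_fin {d : ℕ} (a b : ℝ) (x : Fin d → ℝ) (h : ℝ) :
    volume ((Ioo a b) ×ˢ (pi univ fun j => Ioo (x j - h) (x j + h)) : Set (ℝ × (Fin d → ℝ))) < ⊤ := by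
  apply Bornology.IsBounded.measure_lt_top
  exact (Metric.isBounded_Ioo a b).prod (Bornology.IsBounded.pi fun j => Metric.isBounded_Ioo _ _)

lemma cyl_sub_box {d : ℕ} (t : ℝ) (x : Fin d → ℝ) {ρ : ℝ} (hρ : 0 < ρ) :
    cylQ d t x ρ ⊆ (Ioo (t - ρ ^ 2) t) ×ˢ (pi univ fun j => Ioo (x j - ρ) (x j + ρ)) := by
  rintro z ⟨z1, z3, z4⟩
  refine ⟨z1, fun j _ => ?_⟩
  have : (z.2 j - x j) ^ 2 < ρ ^ 2 := by
    by_cases hj : (j : ℕ) < 2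
    · refine lt_of_le_of_lt ?_ z3
      have := Finset.single_le_sum (f := fun j : Fin d => if (j : ℕ) < 2 then (z.2 j - x j) ^ 2 else 0)
        (fun j _ => by split_ifs <;> positivity) (Finset.mem_univ j)
      simpa [hj] using this
    · refine lt_of_le_of_lt ?_ z4
      have := Finset.single_le_sum (f := fun j : Fin d => if (j : ℕ) < 2 then 0 else (z.2 j - x j) ^ 2)
        (fun j _ => by split_ifs <;> positivity) (Finset.mem_univ j)
      simpa [hj] using this
  have := abs_lt_of_sq_lt_sq this hρ.le
  rw [abs_lt] at this
  exact ⟨by linarith, by linarith⟩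

lemma box_sub_cyl {d : ℕ} (hd : 0 < d) (t : ℝ) (x : Fin d → ℝ) {ρ : ℝ} (hρ : 0 < ρ) :
    (Ioo (t - ρ ^ 2) t) ×ˢ (pi univ fun j => Ioo (x j - ρ / (2 * d)) (x j + ρ / (2 * d)))
      ⊆ cylQ d t x ρ := by
  rintro z ⟨z1, z2⟩
  have hd' : (1 : ℝ) ≤ d := by exact_mod_cast hd
  have hz : ∀ j, (z.2 j - x j) ^ 2 ≤ (ρ / (2 * d)) ^ 2 := by
    intro j
    have := z2 j (mem_univ j)
    have h : |z.2 j - x j| ≤ ρ / (2 * d) := by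
      rw [abs_le]; exact ⟨by linarith [this.1], by linarith [this.2]⟩
    rw [← sq_abs]; gcongr
  have hs : ∑ j : Fin d, (ρ / (2 * d)) ^ 2 < ρ ^ 2 := by
    rw [Finset.sum_const, Finset.card_univ, Fintype.card_fin, nsmul_eq_mul, div_pow]
    have : (d : ℝ) * (ρ ^ 2 / (2 * d) ^ 2) = ρ ^ 2 / (4 * d) := by field_simp; norm_num
    rw [this, div_lt_iff₀ (by positivity)]
    nlinarith [sq_pos_of_pos hρ]
  refine ⟨z1, lt_of_le_of_lt (Finset.sum_le_sum fun j _ => ?_) hs,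
    lt_of_le_of_lt (Finset.sum_le_sum fun j _ => ?_) hs⟩
  · split_ifs
    · exact hz j
    · positivity
  · split_ifs
    · positivity
    · exact hz j

lemma cyl_fin {d : ℕ} (t : ℝ) (x : Fin d → ℝ) {ρ : ℝ} (hρ : 0 < ρ) : volume (cylQ d t x ρ) < ⊤ :=
  lt_of_le_of_lt (measure_mono (cyl_sub_box t x hρ)) (box_fin _ _ _ _)

lemma cyl_vol_le {d : ℕ} (t : ℝ) (x : Fin d → ℝ) {ρ : ℝ} (hρ : 0 < ρ) :
    volume.real (cylQ d t x ρ) ≤ 2 ^ d * ρ ^ (d + 2) := by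
  have h := measureReal_mono (μ := volume) (cyl_sub_box t x hρ) (box_fin _ _ _ _).ne
  rw [box_real _ _ (by nlinarith) _ _ hρ.le] at h
  refine h.trans (le_of_eq ?_)
  rw [mul_pow, pow_add]; ring

lemma le_cyl_vol {d : ℕ} (hd : 0 < d) (t : ℝ) (x : Fin d → ℝ) {ρ : ℝ} (hρ : 0 < ρ) :
    (1 / (d : ℝ)) ^ d * ρ ^ (d + 2) ≤ volume.real (cylQ d t x ρ) := by
  have h := measureReal_mono (μ := volume) (box_sub_cyl hd t x hρ) (cyl_fin t x hρ).ne
  rw [box_real _ _ (by nlinarith) _ _ (by positivity)] at h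
  refine le_trans (le_of_eq ?_) h
  have hd' : (0 : ℝ) < d := by exact_mod_cast hd
  have : 2 * (ρ / (2 * d)) = (1 / (d : ℝ)) * ρ := by field_simp
  rw [this, mul_pow, pow_add]; ring

lemma cyl_bdd {d : ℕ} (t : ℝ) (x : Fin d → ℝ) {ρ : ℝ} (hρ : 0 < ρ) :
    Bornology.IsBounded (cylQ d t x ρ) :=
  ((Metric.isBounded_Ioo _ _).prod (Bornology.IsBounded.pi fun j => Metric.isBounded_Ioo _ _)).subset
    (cyl_sub_box t x hρ)

lemma cyl_int {d : ℕ} (t : ℝ) (x : Fin d → ℝ) {ρ : ℝ} (hρ : 0 < ρ) {f : ℝ × (Fin d → ℝ) → ℝ}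
    (hf : Continuous f) : IntegrableOn f (cylQ d t x ρ) := by
  have h1 : IsCompact (closure (cylQ d t x ρ)) := (cyl_bdd t x hρ).isCompact_closure
  exact (hf.continuousOn.integrableOn_compact h1).mono_set subset_closure

lemma cyl_near {d : ℕ} (t : ℝ) (x : Fin d → ℝ) {ρ : ℝ} (hρ : 0 < ρ) : (t, x) ∈ closure (cylQ d t x ρ) := by
  have hlim : Tendsto (fun s : ℝ => ((t - s, x) : ℝ × (Fin d → ℝ))) (nhdsWithin 0 (Ioi 0)) (nhds (t, x)) := by
    have : Continuous (fun s : ℝ => ((t - s, x) : ℝ × (Fin d → ℝ))) := by fun_prop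
    have := this.tendsto 0
    rw [sub_zero] at this
    exact this.mono_left nhdsWithin_le_nhds
  refine mem_closure_of_tendsto hlim ?_
  have h2 : (0 : ℝ) < ρ ^ 2 := by positivity
  filter_upwards [Ioo_mem_nhdsGT h2] with s hs
  refine ⟨⟨by simp only; linarith [hs.2], by simp only; linarith [hs.1]⟩, ?_, ?_⟩ <;> simpa using h2

lemma sup_L2 (d : ℕ) (hd : 0 < d) (δ : ℝ) (hδ : 0 < δ) (hδ1 : δ ≤ 1) (i0 i1 : Fin d)
    (hi0 : (i0 : ℕ) = 0) (hi1 : (i1 : ℕ) = 1) :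
    ∃ K : ℝ, 0 < K ∧ ∀ (a : ℝ × (Fin d → ℝ) → Fin d → Fin d → ℝ), Good δ i0 i1 a →
      ∀ v : ℝ × (Fin d → ℝ) → ℝ, Sm v → ∀ (R : ℝ), 0 < R →
      (∀ p ∈ cylQ d 0 0 R, Lop a v p = 0) →
      ∀ p ∈ cylQ d 0 0 (R / 2), v p ^ 2 ≤ K * ⨍ q in cylQ d 0 0 R, v q ^ 2 ∂volume := by
  obtain ⟨C, hC, hosc⟩ := scaled_osc d δ hδ hδ1 i0 i1 hi0 hi1
  obtain ⟨s, hs0, hs8, hs⟩ : ∃ s : ℝ, 0 < s ∧ s ≤ 1 / 8 ∧ C * 2 ^ (d + 3) * s ^ (δ ^ 2 / 8) ≤ 1 / 2 := by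
    have hlim : Tendsto (fun s : ℝ => C * 2 ^ (d + 3) * s ^ (δ ^ 2 / 8)) (nhdsWithin 0 (Ioi 0)) (nhds 0) := by
      have : Continuous (fun s : ℝ => C * 2 ^ (d + 3) * s ^ (δ ^ 2 / 8)) :=
        continuous_const.mul (Real.continuous_rpow_const (by positivity))
      have := this.tendsto 0
      rw [Real.zero_rpow (by positivity), mul_zero] at this
      exact this.mono_left nhdsWithin_le_nhds
    have h1 := hlim.eventually (gt_mem_nhds (show (0 : ℝ) < 1 / 2 by norm_num))
    have h2 := Ioo_mem_nhdsGT (show (0 : ℝ) < 1 / 8 by norm_num)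
    obtain ⟨s, hs1, hs2⟩ := (h1.and h2).exists
    exact ⟨s, hs2.1, hs2.2.le, hs1.le⟩
  set c : ℝ := (1 / (d : ℝ)) ^ d * (s / 2) ^ (d + 2) / 4 with hc
  have hc0 : 0 < c := by
    have : (0 : ℝ) < d := by exact_mod_cast hd
    positivity
  refine ⟨2 ^ (d + 2) * (2 * c⁻¹) * 2 ^ d, by positivity, ?_⟩
  intro a hG v hv R hR hL p0 hp0
  have hvc : Continuous v := hv.continuous
  set I := ∫ q in cylQ d 0 0 R, v q ^ 2 with hI
  have hI0 : 0 ≤ I := integral_nonneg fun _ => sq_nonneg _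
  have hint : IntegrableOn (fun q => v q ^ 2) (cylQ d 0 0 R) := cyl_int 0 0 hR (hvc.pow 2)
  let S : Set ℝ := {y | ∃ (p : ℝ × (Fin d → ℝ)) (σ : ℝ), p ∈ cylQ d 0 0 R ∧ 0 < σ ∧ σ ≤ R ∧
    cylQ d p.1 p.2 σ ⊆ cylQ d 0 0 R ∧ y = σ ^ (d + 2) * v p ^ 2}
  have hSb : BddAbove S := by
    obtain ⟨B, hB⟩ := (cyl_bdd (0:ℝ) (0 : Fin d → ℝ) hR).isCompact_closure.exists_bound_of_continuousOn
      (hvc.pow 2).continuousOn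
    refine ⟨R ^ (d + 2) * B, ?_⟩
    rintro y ⟨p, σ, hp, h0, h1, -, rfl⟩
    have := hB p (subset_closure hp)
    rw [Real.norm_eq_abs] at this
    have h2 := (le_abs_self _).trans this
    have : σ ^ (d + 2) ≤ R ^ (d + 2) := by gcongr
    simp only [Pi.pow_apply] at h2
    exact mul_le_mul this h2 (sq_nonneg _) (by positivity)
  have hSm : ∀ (p : ℝ × (Fin d → ℝ)) (σ : ℝ), p ∈ cylQ d 0 0 R → 0 < σ → σ ≤ R →
      cylQ d p.1 p.2 σ ⊆ cylQ d 0 0 R → σ ^ (d + 2) * v p ^ 2 ≤ sSup S :=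
    fun p σ h1 h2 h3 h4 => le_csSup hSb ⟨p, σ, h1, h2, h3, h4, rfl⟩
  have hp0R : p0 ∈ cylQ d 0 0 R := cyl_mono (by positivity) (by linarith) hp0
  have hmain : sSup S ≤ 2 * c⁻¹ * I := by
    rcases le_or_gt (sSup S) 0 with hS0 | hS0
    · exact hS0.trans (by positivity)
    have hne : S.Nonempty := ⟨_, p0, R / 2, hp0R, by positivity, by linarith, cyl_sub hp0, rfl⟩
    obtain ⟨y, ⟨p, σ, hp, hσ, hσR, hsub, rfl⟩, hy⟩ := exists_lt_of_lt_csSup hne (half_lt_self hS0)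
    have hvp : 0 < |v p| := by
      rw [abs_pos]; rintro h; rw [h] at hy; simp at hy; linarith
    have hb : ∀ q ∈ cylQ d p.1 p.2 (σ / 2), |v q| ≤ 2 ^ (d + 3) * |v p| := by
      intro q hq
      have h1 := hSm q (σ / 2) (hsub (cyl_mono (by positivity) (by linarith) hq)) (by positivity)
        (by linarith) ((cyl_sub hq).trans hsub)
      have h2 : (σ / 2) ^ (d + 2) * v q ^ 2 ≤ (σ / 2) ^ (d + 2) * (2 ^ (d + 3) * v p ^ 2) := by
        have : (σ / 2) ^ (d + 2) * (2 ^ (d + 3) * v p ^ 2) = 2 * (σ ^ (d + 2) * v p ^ 2) := by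
          rw [div_pow]; field_simp; ring
        linarith
      have h3 := le_of_mul_le_mul_left h2 (by positivity)
      apply abs_le_of_sq_le_sq' _ (by positivity) |> abs_le.2
      rw [mul_pow, sq_abs]
      refine h3.trans ?_
      gcongr
      exact le_self_pow₀ (one_le_pow₀ (by norm_num)) (by norm_num)
    have ho := hosc a hG v hv p.1 p.2 (σ / 2) (2 ^ (d + 3) * |v p|) (by positivity) (by positivity)
      (fun q hq => hL q (hsub (cyl_mono (by positivity) (by linarith) hq))) hb s hs0 hs8
    have ho2 : ∀ q ∈ cylQ d p.1 p.2 (s * (σ / 2)), |v q - v p| ≤ |v p| / 2 := by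
      intro q hq
      have hcl : IsClosed {z | |v q - v z| ≤ |v p| / 2} :=
        isClosed_le (continuous_const.sub hvc).abs continuous_const
      have hsubc : cylQ d p.1 p.2 (s * (σ / 2)) ⊆ {z | |v q - v z| ≤ |v p| / 2} := by
        intro z hz
        refine (ho q hq z hz).trans ?_
        have := mul_le_mul_of_nonneg_right hs hvp.le
        linarith
      exact closure_minimal hsubc hcl (cyl_near p.1 p.2 (by positivity))
    have hlow : ∀ q ∈ cylQ d p.1 p.2 (s * (σ / 2)), v p ^ 2 / 4 ≤ v q ^ 2 := by
      intro q hq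
      have h1 := ho2 q hq
      have h2 : |v p| / 2 ≤ |v q| := by
        have := abs_sub_abs_le_abs_sub (v p) (v q)
        rw [abs_sub_comm] at this
        linarith
      rw [← sq_abs (v p), ← sq_abs (v q)]
      nlinarith
    have hρ : 0 < s * (σ / 2) := by positivity
    have hsub2 : cylQ d p.1 p.2 (s * (σ / 2)) ⊆ cylQ d 0 0 R :=
      (cyl_mono hρ.le (by nlinarith)).trans hsub
    have h1 : ∫ q in cylQ d p.1 p.2 (s * (σ / 2)), v q ^ 2 ≤ I :=
      setIntegral_mono_set hint (Eventually.of_forall fun _ => sq_nonneg _) hsub2.eventuallyLE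
    have h2 : v p ^ 2 / 4 * volume.real (cylQ d p.1 p.2 (s * (σ / 2)))
        ≤ ∫ q in cylQ d p.1 p.2 (s * (σ / 2)), v q ^ 2 := by
      have := setIntegral_mono_on (μ := volume) (f := fun _ => v p ^ 2 / 4) (g := fun q => v q ^ 2)
        (s := cylQ d p.1 p.2 (s * (σ / 2))) (cyl_int _ _ hρ continuous_const)
        (cyl_int _ _ hρ (hvc.pow 2)) (cyl_open _ _ _ _).measurableSet hlow
      rw [setIntegral_const, smul_eq_mul] at this
      linarith
    have h3 := le_cyl_vol hd p.1 p.2 hρ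
    have h4 := mul_le_mul_of_nonneg_left h3 (show 0 ≤ v p ^ 2 / 4 by positivity)
    have h5 : v p ^ 2 / 4 * ((1 / (d : ℝ)) ^ d * (s * (σ / 2)) ^ (d + 2)) = c * (σ ^ (d + 2) * v p ^ 2) := by
      rw [hc, show s * (σ / 2) = s / 2 * σ by ring, mul_pow]; ring
    have h6 : σ ^ (d + 2) * v p ^ 2 ≤ c⁻¹ * I := by
      rw [le_inv_mul_iff₀ hc0]; linarith
    linarith
  have h1 := (hSm p0 (R / 2) hp0R (by positivity) (by linarith) (cyl_sub hp0)).trans hmain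
  have hV := cyl_vol_le (0 : ℝ) (0 : Fin d → ℝ) hR
  have hVp : 0 < volume.real (cylQ d 0 0 R) := by
    refine lt_of_lt_of_le ?_ (le_cyl_vol hd _ _ hR)
    have : (0 : ℝ) < d := by exact_mod_cast hd
    positivity
  rw [setAverage_eq, smul_eq_mul, ← hI]
  have h2 : I / (2 ^ d * R ^ (d + 2)) ≤ (volume.real (cylQ d 0 0 R))⁻¹ * I := by
    rw [inv_mul_eq_div]; gcongr
  have h3 : v p0 ^ 2 ≤ 2 ^ (d + 2) * (2 * c⁻¹) * 2 ^ d * (I / (2 ^ d * R ^ (d + 2))) := by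
    have e : 2 ^ (d + 2) * (2 * c⁻¹) * 2 ^ d * (I / (2 ^ d * R ^ (d + 2))) = (2 * c⁻¹ * I) / (R / 2) ^ (d + 2) := by
      rw [div_pow]; field_simp
    rw [e, le_div_iff₀ (by positivity)]; linarith
  exact h3.trans (mul_le_mul_of_nonneg_left h2 (by positivity))


lemma avg_osc {d : ℕ} (hd : 0 < d) {r D : ℝ} (hr : 0 < r) {v : ℝ × (Fin d → ℝ) → ℝ} (hv : Continuous v)
    (hD : 0 ≤ D) (h : ∀ p ∈ cylQ d 0 0 r, ∀ q ∈ cylQ d 0 0 r, |v p - v q| ≤ D) :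
    (⨍ q in cylQ d 0 0 r, (v q - ⨍ q' in cylQ d 0 0 r, v q' ∂volume) ^ 2 ∂volume) ≤ D ^ 2 := by
  have hm := (cyl_open d 0 0 r).measurableSet
  have hfin := (cyl_fin (0 : ℝ) (0 : Fin d → ℝ) hr).ne
  have h0 : volume (cylQ d 0 0 r) ≠ 0 := by
    intro h
    have h1 := le_cyl_vol hd 0 (0 : Fin d → ℝ) hr
    rw [Measure.real, h] at h1
    have : (0 : ℝ) < d := by exact_mod_cast hd
    have : 0 < (1 / (d : ℝ)) ^ d * r ^ (d + 2) := by positivity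
    simp only [ENNReal.toReal_zero] at h1
    linarith
  set m := ⨍ q' in cylQ d 0 0 r, v q' ∂volume with hmd
  have h1 : ∀ p ∈ cylQ d 0 0 r, (v p - m) ^ 2 ≤ D ^ 2 := by
    intro p hp
    have := (convex_Icc (v p - D) (v p + D)).set_average_mem isClosed_Icc h0 hfin (f := v)
      ((ae_restrict_iff' hm).2 (Eventually.of_forall fun q hq => by
        have := abs_le.1 (h p hp q hq)
        exact ⟨by linarith [this.2], by linarith [this.1]⟩)) (cyl_int 0 0 hr hv)
    rw [← hmd] at this
    exact sq_le_sq' (by linarith [this.2]) (by linarith [this.1])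
  exact (convex_Iic (D ^ 2)).set_average_mem isClosed_Iic h0 hfin (f := fun q => (v q - m) ^ 2)
    ((ae_restrict_iff' hm).2 (Eventually.of_forall h1)) (cyl_int 0 0 hr ((hv.sub continuous_const).pow 2))

lemma pdList_sm {d : ℕ} {u : ℝ × (Fin d → ℝ) → ℝ} (hu : Sm u) (ms : List (Fin d)) : Sm (pdList ms u) := by
  induction ms with
  | nil => exact hu
  | cons j ms ih => exact ih.pd j

lemma pdList_eq {d : ℕ} {a : ℝ × (Fin d → ℝ) → Fin d → Fin d → ℝ} (hi : Ind a)
    {u : ℝ × (Fin d → ℝ) → ℝ} (hu : Sm u) {U : Set (ℝ × (Fin d → ℝ))} (hU : IsOpen U)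
    (h : ∀ p ∈ U, Lop a u p = 0) (ms : List (Fin d)) (hms : ∀ j ∈ ms, 2 ≤ (j : ℕ)) :
    ∀ p ∈ U, Lop a (pdList ms u) p = 0 := by
  induction ms with
  | nil => exact h
  | cons j ms ih =>
    exact diff_eq hi (pdList_sm hu ms) hU (ih fun k hk => hms k (List.mem_cons_of_mem _ hk)) j
      (hms j List.mem_cons_self)

lemma main_osc (d : ℕ) (hd : 0 < d) (δ : ℝ) (hδ : 0 < δ) (hδ1 : δ ≤ 1) (i0 i1 : Fin d)
    (hi0 : (i0 : ℕ) = 0) (hi1 : (i1 : ℕ) = 1) :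
    ∃ N : ℝ, 0 < N ∧ ∀ (a : ℝ × (Fin d → ℝ) → Fin d → Fin d → ℝ), Good δ i0 i1 a →
      ∀ v : ℝ × (Fin d → ℝ) → ℝ, Sm v → ∀ (κ r : ℝ), 2 ≤ κ → 0 < r →
      (∀ p ∈ cylQ d 0 0 (κ * r), Lop a v p = 0) →
      (⨍ q in cylQ d 0 0 r, (v q - ⨍ q' in cylQ d 0 0 r, v q' ∂volume) ^ 2 ∂volume)
        ≤ N * κ ^ (-(2 * (δ ^ 2 / 8))) * ⨍ q in cylQ d 0 0 (κ * r), v q ^ 2 ∂volume := by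
  obtain ⟨C, hC, hosc⟩ := scaled_osc d δ hδ hδ1 i0 i1 hi0 hi1
  obtain ⟨K, hK, hsup⟩ := sup_L2 d hd δ hδ hδ1 i0 i1 hi0 hi1
  refine ⟨4 * C ^ 2 * K + 1024 * K, by positivity, ?_⟩
  intro a hG v hv κ r hκ hr hL
  set α := δ ^ 2 / 8 with hα
  have hα0 : 0 < α := by positivity
  have hα1 : α ≤ 1 := by nlinarith
  have hκ0 : 0 < κ := by linarith
  have hR : 0 < κ * r := by positivity
  set A := ⨍ q in cylQ d 0 0 (κ * r), v q ^ 2 ∂volume with hA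
  have hs := hsup a hG v hv (κ * r) hR hL
  rw [← hA] at hs
  have hA0 : 0 ≤ A := by
    rw [hA, setAverage_eq, smul_eq_mul]
    exact mul_nonneg (by positivity) (integral_nonneg fun _ => sq_nonneg _)
  have hs' : ∀ p ∈ cylQ d 0 0 (κ * r / 2), |v p| ≤ √(K * A) := by
    intro p hp
    exact Real.abs_le_sqrt (hs p hp)
  have hsub : cylQ d 0 0 r ⊆ cylQ d 0 0 (κ * r / 2) := cyl_mono hr.le (by nlinarith)
  have hM2 : √(K * A) ^ 2 = K * A := Real.sq_sqrt (by positivity)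
  have hκα : κ ^ (-(2 * α)) = (κ ^ (-α)) ^ 2 := by
    rw [← Real.rpow_natCast, ← Real.rpow_mul hκ0.le]; congr 1; push_cast; ring
  have hκp : 0 < κ ^ (-α) := by positivity
  rcases lt_or_ge κ 16 with h16 | h16
  · have h1 : 1 / 16 ≤ κ ^ (-α) := by
      rw [Real.rpow_neg hκ0.le, one_div]
      apply inv_anti₀ (by positivity)
      calc κ ^ α ≤ κ ^ (1 : ℝ) := Real.rpow_le_rpow_of_exponent_le (by linarith) hα1
        _ ≤ 16 := by rw [Real.rpow_one]; exact h16.le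
    have h2 : 1 / 256 ≤ (κ ^ (-α)) ^ 2 := by nlinarith
    refine (avg_osc hd hr hv.continuous (D := 2 * √(K * A)) (by positivity) ?_).trans ?_
    · intro p hp q hq
      have h3 := hs' p (hsub hp)
      have h4 := hs' q (hsub hq)
      have := abs_sub (v p) (v q)
      linarith
    · rw [mul_pow, hM2, hκα]
      have hKA : 0 ≤ K * A := by positivity
      have h3 := mul_le_mul_of_nonneg_right h2 hKA
      have h4 : 0 ≤ C ^ 2 * (κ ^ (-α)) ^ 2 * (K * A) := by positivity
      nlinarith
  · rcases hA0.eq_or_lt with hA1 | hA1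
    · refine (avg_osc hd hr hv.continuous (D := 0) le_rfl ?_).trans ?_
      · intro p hp q hq
        have h3 := hs' p (hsub hp)
        have h4 := hs' q (hsub hq)
        rw [← hA1, mul_zero, Real.sqrt_zero] at h3 h4
        have := abs_sub (v p) (v q)
        linarith
      · rw [← hA1]; simp
    · have hM : 0 < √(K * A) := Real.sqrt_pos.2 (by positivity)
      have hs8 : 2 / κ ≤ 1 / 8 := by rw [div_le_div_iff₀ hκ0 (by norm_num)]; linarith
      have ho := hosc a hG v hv 0 0 (κ * r / 2) (√(K * A)) (by positivity) hM
        (fun p hp => hL p (cyl_mono (by positivity) (by linarith) hp)) hs' (2 / κ) (by positivity) hs8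
      have e : 2 / κ * (κ * r / 2) = r := by field_simp
      rw [e] at ho
      refine (avg_osc hd hr hv.continuous (by positivity) ho).trans ?_
      have e2 : (2 / κ) ^ α = 2 ^ α * κ ^ (-α) := by
        rw [Real.div_rpow (by norm_num) hκ0.le, Real.rpow_neg hκ0.le]; rfl
      have h2 : (2 : ℝ) ^ α ≤ 2 := by
        calc (2 : ℝ) ^ α ≤ 2 ^ (1 : ℝ) := Real.rpow_le_rpow_of_exponent_le (by norm_num) hα1
          _ = 2 := Real.rpow_one _
      have h3 : ((2 : ℝ) ^ α) ^ 2 ≤ 4 := by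
        have : (0 : ℝ) < 2 ^ α := by positivity
        nlinarith
      rw [e2, hκα]
      have e3 : (C * √(K * A) * (2 ^ α * κ ^ (-α))) ^ 2
          = ((2 : ℝ) ^ α) ^ 2 * (C ^ 2 * (K * A) * (κ ^ (-α)) ^ 2) := by
        rw [mul_pow, mul_pow, mul_pow, hM2]; ring
      rw [e3]
      have h4 : 0 ≤ C ^ 2 * (K * A) * (κ ^ (-α)) ^ 2 := by positivity
      have h5 := mul_le_mul_of_nonneg_right h3 h4
      have h6 : 0 ≤ (K * A) * (κ ^ (-α)) ^ 2 := by positivity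
      nlinarith

/-- **Theorem 3.5**: interior oscillation estimate.  If `Lu = 0` in `Q_{κr}` for the operator
`Lu = -u_t + a^{jk}(t,x')D_{jk}u` with `tr a` depending only on `t`, then for any derivative
`D^{γ''}u` in the `x''` variables only, the mean square oscillation of `D^{γ''}u` over `Q_r`
is at most `N κ^{-2α}` times the mean of `|D^{γ''}u|²` over `Q_{κr}`. -/
theorem statement15 (d : ℕ) (hd : 3 ≤ d) (δ : ℝ) (hδ0 : 0 < δ) (hδ1 : δ ≤ 1) :
    ∃ N α : ℝ, 0 < N ∧ 0 < α ∧ α ≤ 1 ∧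
      ∀ (a : ℝ × (Fin d → ℝ) → Fin d → Fin d → ℝ),
        (∀ j k, Measurable fun q => a q j k) →
        Elliptic δ a →
        -- the coefficients depend only on (t, x')
        (∀ (j k : Fin d) (t : ℝ) (x y : Fin d → ℝ),
          (∀ i : Fin d, (i : ℕ) < 2 → x i = y i) → a (t, x) j k = a (t, y) j k) →
        -- tr a depends only on t
        (∀ (t : ℝ) (x y : Fin d → ℝ),
          trA (by omega) a (t, x) = trA (by omega) a (t, y)) →
        ∀ (κ r : ℝ), 2 ≤ κ → 0 < r →
        ∀ u : ℝ × (Fin d → ℝ) → ℝ, ContDiff ℝ (⊤ : ℕ∞) u → HasCompactSupport u →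
          -- Lu = 0 in Q_{κ r}
          (∀ q ∈ cylQ d 0 0 (κ * r), parOp a (fun _ _ => 0) (fun _ => 0) u q = 0) →
          -- for any multi-index γ'' involving only the x'' variables
          ∀ ms : List (Fin d), (∀ j ∈ ms, 2 ≤ (j : ℕ)) →
            (⨍ q in cylQ d 0 0 r,
                (pdList ms u q - ⨍ q' in cylQ d 0 0 r, pdList ms u q' ∂volume) ^ 2
              ∂volume)
            ≤ N * κ ^ (-(2 * α)) *
                ⨍ q in cylQ d 0 0 (κ * r), (pdList ms u q) ^ 2 ∂volume := by
  obtain ⟨N, hN, h⟩ := main_osc d (by omega) δ hδ0 hδ1 ⟨0, by omega⟩ ⟨1, by omega⟩ rfl rfl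
  refine ⟨N, δ ^ 2 / 8, hN, by positivity, by nlinarith, ?_⟩
  intro a _ hE hI hT κ r hκ hr u hu _ hL ms hms
  have hG : Good δ (⟨0, by omega⟩ : Fin d) ⟨1, by omega⟩ a :=
    ⟨hE, hI, fun t x y => hT t x y⟩
  refine h a hG (pdList ms u) (pdList_sm hu ms) κ r hκ hr ?_
  exact pdList_eq hI hu (cyl_open _ _ _ _) (fun p hp => by rw [← parOp_eq]; exact hL p hp) ms hms

end
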